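/- arXiv:1402.6457 — 9 statements merged into one kernel-verified Lean document; each statement's English description precedes it below -/
import Mathlib

section
/- For every shortest path tree T_SPT of a network G with sink r and every routing tree T of G, if |V| ≥ 2 then COST(T_SPT) < 2·COST(T). In particular, a shortest path tree algorithm is a 2-approximation algorithm for the minimum energy-cost aggregation tree problem. -/
open Finset

variable {V : Type*} [Fintype V] [DecidableEq V]

/-- A routing tree for a network `G` with sink `r`: every vertex `v ≠ r` has a unique
parent adjacent to it in `G`, and iterating parents reaches `r`. -/
structure RoutingTree (G : SimpleGraph V) (r : V) where
  parent : V → V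
  parent_root : parent r = r
  adj : ∀ v, v ≠ r → G.Adj v (parent v)
  reaches : ∀ v, ∃ n, parent^[n] v = r

open scoped Classical in
/-- `des s T v`: the total size of reports of the proper descendants of `v` in `T`,
i.e. of the vertices `u ≠ v` whose tree path to the root passes through `v`. -/
noncomputable def des {G : SimpleGraph V} {r : V} (s : V → ℕ)
    (T : RoutingTree G r) (v : V) : ℕ :=
  ∑ u ∈ Finset.univ, if u ≠ v ∧ (∃ n, T.parent^[n] u = v) then s u else 0

/-- The energy cost of a routing tree:
`COST(T) = (Tx+Rx) · Σ_{v ≠ r} ⌈(des_T(v)+s(v))/q⌉`. -/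
noncomputable def cost {G : SimpleGraph V} {r : V} (s : V → ℕ) (q : ℕ)
    (Tx Rx : ℝ) (T : RoutingTree G r) : ℝ :=
  (Tx + Rx) * ∑ v ∈ Finset.univ.erase r, (⌈(((des s T v + s v : ℕ) : ℝ) / (q : ℝ))⌉ : ℝ)

/-- The hop distance from `v` to the root `r` in the routing tree `T`. -/
noncomputable def treeDist {G : SimpleGraph V} (r : V) (T : RoutingTree G r) (v : V) : ℕ :=
  sInf {n : ℕ | T.parent^[n] v = r}

/-- A shortest path tree: every vertex's hop distance to `r` in `T` equals its hop
distance to `r` in `G`. -/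
def IsSPT {G : SimpleGraph V} (r : V) (T : RoutingTree G r) : Prop :=
  ∀ v, treeDist r T v = G.dist v r

open scoped Classical in
/-- The vertices other than the sink on the tree path from `u` to the sink. -/
noncomputable def RoutingTree.ancestors {G : SimpleGraph V} {r : V} (T : RoutingTree G r)
    (u : V) : Finset V :=
  (Finset.univ.erase r).filter fun v => ∃ n, T.parent^[n] u = v

theorem RoutingTree.mem_ancestors {G : SimpleGraph V} {r : V} (T : RoutingTree G r) {u v : V} :
    v ∈ T.ancestors u ↔ v ≠ r ∧ ∃ n, T.parent^[n] u = v := by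
  simp [RoutingTree.ancestors]

open scoped Classical in
theorem des_add_eq_sum {G : SimpleGraph V} {r : V} (s : V → ℕ) (T : RoutingTree G r) (v : V) :
    des s T v + s v = ∑ u, if ∃ n, T.parent^[n] u = v then s u else 0 := by
  have h : s v = ∑ u, if u = v then s u else 0 := by simp
  rw [des]
  rw [h, ← Finset.sum_add_distrib]
  refine Finset.sum_congr rfl fun u _ => ?_
  by_cases huv : u = v
  · simp [huv, show ∃ n, T.parent^[n] v = v from ⟨0, rfl⟩]
  · simp [huv]

/-- Double counting: the total load of the tree is the sum of report sizes weighted by depth. -/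
theorem sum_des_add_eq {G : SimpleGraph V} {r : V} (s : V → ℕ) (T : RoutingTree G r) :
    ∑ v ∈ Finset.univ.erase r, (des s T v + s v) = ∑ u, (T.ancestors u).card * s u := by
  classical
  simp only [des_add_eq_sum]
  rw [Finset.sum_comm]
  refine Finset.sum_congr rfl fun u _ => ?_
  rw [← Finset.sum_filter, Finset.sum_const, smul_eq_mul]
  congr 2

theorem RoutingTree.card_ancestors_le_treeDist {G : SimpleGraph V} {r : V}
    (T : RoutingTree G r) (u : V) : (T.ancestors u).card ≤ treeDist r T u := by
  have hd : T.parent^[treeDist r T u] u = r := Nat.sInf_mem (T.reaches u)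
  have hsub : T.ancestors u ⊆ (Finset.range (treeDist r T u)).image fun n => T.parent^[n] u := by
    intro v hv
    obtain ⟨hvr, n, hn⟩ := T.mem_ancestors.1 hv
    refine Finset.mem_image.2 ⟨n, Finset.mem_range.2 ?_, hn⟩
    by_contra! hlt
    obtain ⟨k, rfl⟩ := Nat.exists_eq_add_of_le' hlt
    rw [Function.iterate_add_apply, hd, Function.iterate_fixed T.parent_root] at hn
    exact hvr hn.symm
  exact (Finset.card_le_card hsub).trans (Finset.card_image_le.trans_eq (Finset.card_range _))

omit [Fintype V] [DecidableEq V] in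
/-- The tree path from `u` to the sink meets every distance level below that of `u`. -/
theorem RoutingTree.exists_iterate_dist_eq {G : SimpleGraph V} (hG : G.Connected) {r : V}
    (T : RoutingTree G r) (n : ℕ) (u : V) (hn : T.parent^[n] u = r) (k : ℕ) (hk : 1 ≤ k)
    (hku : k ≤ G.dist u r) : ∃ m, G.dist (T.parent^[m] u) r = k := by
  induction n generalizing u with
  | zero =>
    obtain rfl : u = r := hn
    simp at hku
    omega
  | succ n ih =>
    obtain rfl | hlt := hku.eq_or_lt
    · exact ⟨0, rfl⟩
    · have hur : u ≠ r := by
        rintro rfl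
        simp at hlt
      have htri : G.dist u r ≤ G.dist u (T.parent u) + G.dist (T.parent u) r :=
        hG.dist_triangle
      rw [SimpleGraph.dist_eq_one_iff_adj.2 (T.adj u hur)] at htri
      obtain ⟨m, hm⟩ := ih (T.parent u) hn (by omega)
      exact ⟨m + 1, hm⟩

theorem RoutingTree.dist_le_card_ancestors {G : SimpleGraph V} (hG : G.Connected) {r : V}
    (T : RoutingTree G r) (u : V) : G.dist u r ≤ (T.ancestors u).card := by
  obtain ⟨n, hn⟩ := T.reaches u
  have hsub : Finset.Icc 1 (G.dist u r) ⊆ (T.ancestors u).image fun v => G.dist v r := by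
    intro k hk
    obtain ⟨hk1, hku⟩ := Finset.mem_Icc.1 hk
    obtain ⟨m, hm⟩ := T.exists_iterate_dist_eq hG n u hn k hk1 hku
    refine Finset.mem_image.2 ⟨_, T.mem_ancestors.2 ⟨fun h => ?_, m, rfl⟩, hm⟩
    rw [h, SimpleGraph.dist_self] at hm
    omega
  simpa using (Finset.card_le_card hsub).trans Finset.card_image_le

/-- A shortest path tree minimizes the total load. -/
theorem IsSPT.sum_des_add_le {G : SimpleGraph V} (hG : G.Connected) {r : V} (s : V → ℕ)
    {TSPT : RoutingTree G r} (hSPT : IsSPT r TSPT) (T : RoutingTree G r) :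
    ∑ v ∈ Finset.univ.erase r, (des s TSPT v + s v) ≤
      ∑ v ∈ Finset.univ.erase r, (des s T v + s v) := by
  rw [sum_des_add_eq, sum_des_add_eq]
  refine Finset.sum_le_sum fun u _ => Nat.mul_le_mul_right _ ?_
  exact (TSPT.card_ancestors_le_treeDist u).trans
    ((hSPT u).le.trans (T.dist_le_card_ancestors hG u))

/-- For every shortest path tree `T_SPT` and every routing tree `T` of a connected network
`G` with at least two nodes, `COST(T_SPT) < 2·COST(T)`: a shortest path tree algorithm is a
2-approximation algorithm for the minimum energy-cost aggregation tree problem. -/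
theorem spt_two_approximation (G : SimpleGraph V) (hG : G.Connected) (r : V)
    (s : V → ℕ) (hs0 : s r = 0) (hs1 : ∀ v, v ≠ r → 1 ≤ s v)
    (q : ℕ) (hq : 1 ≤ q) (Tx Rx : ℝ) (hTx : 0 < Tx) (hRx : 0 < Rx)
    (hcard : 2 ≤ Fintype.card V)
    (TSPT : RoutingTree G r) (hSPT : IsSPT r TSPT) (T : RoutingTree G r) :
    cost s q Tx Rx TSPT < 2 * cost s q Tx Rx T := by
  have hq0 : (0 : ℝ) < q := by exact_mod_cast hq
  have hne : (Finset.univ.erase r).Nonempty := by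
    rw [← Finset.card_pos, Finset.card_erase_of_mem (Finset.mem_univ r), Finset.card_univ]
    omega
  have hupper : ∑ v ∈ Finset.univ.erase r, (⌈((des s TSPT v + s v : ℕ) : ℝ) / (q : ℝ)⌉ : ℝ) <
      ∑ v ∈ Finset.univ.erase r, (((des s TSPT v + s v : ℕ) : ℝ) / (q : ℝ) + 1) :=
    Finset.sum_lt_sum_of_nonempty hne fun v _ => Int.ceil_lt_add_one _
  have hload : ∑ v ∈ Finset.univ.erase r, ((des s TSPT v + s v : ℕ) : ℝ) / (q : ℝ) ≤
      ∑ v ∈ Finset.univ.erase r, ((des s T v + s v : ℕ) : ℝ) / (q : ℝ) := by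
    rw [← Finset.sum_div, ← Finset.sum_div]
    refine div_le_div_of_nonneg_right ?_ hq0.le
    exact_mod_cast hSPT.sum_des_add_le hG s T
  have hceil : ∑ v ∈ Finset.univ.erase r, ((des s T v + s v : ℕ) : ℝ) / (q : ℝ) ≤
      ∑ v ∈ Finset.univ.erase r, (⌈((des s T v + s v : ℕ) : ℝ) / (q : ℝ)⌉ : ℝ) :=
    Finset.sum_le_sum fun v _ => Int.le_ceil _
  have hone : ∑ _v ∈ Finset.univ.erase r, (1 : ℝ) ≤
      ∑ v ∈ Finset.univ.erase r, (⌈((des s T v + s v : ℕ) : ℝ) / (q : ℝ)⌉ : ℝ) := by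
    refine Finset.sum_le_sum fun v hv => ?_
    have hsv : 0 < des s T v + s v :=
      Nat.add_pos_right _ (hs1 v (Finset.ne_of_mem_erase hv))
    have hpos : (0 : ℝ) < ((des s T v + s v : ℕ) : ℝ) / (q : ℝ) :=
      div_pos (by exact_mod_cast hsv) hq0
    exact_mod_cast Int.one_le_ceil_iff.2 hpos
  rw [Finset.sum_add_distrib] at hupper
  rw [cost, cost, mul_left_comm]
  exact mul_lt_mul_of_pos_left (by linarith) (add_pos hTx hRx)
end

section
/- Let H be a finite bipartite graph with parts U = {u_1,…,u_m} and V = {v_1,…,v_p} and edge set E, let w : U → ℕ with w(u) ≥ 1 for all u, and let k ∈ ℕ with k ≥ 1. Construct the graph G' on vertex set {r} ∪ U ∪ V ∪ W, where W = ⋃_{i=1}^m W_i and W_i = {w_{i,1},…,w_{i,w(u_i)−1}}, with edge set E ∪ {{r, v_j} : 1 ≤ j ≤ p} ∪ {{u_i, w_{i,j}} : 1 ≤ i ≤ m, 1 ≤ j ≤ w(u_i)−1}. Give every vertex of U ∪ V ∪ W report size 1 and give r report size 0, and set q = k+1, Tx = Rx = 1, and C = 2(|W| + Σ_{i=1}^m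 ⌈(|W_i|+1)/q⌉ + |V|). Then H has a semi-matching M with max_{v ∈ V} Σ_{u ∈ Adj_M(v)} w(u) ≤ k if and only if G' has a routing tree (a spanning tree of G' rooted at r) with energy cost at most C. -/
open Finset

variable {V : Type*} [Fintype V] [DecidableEq V]

section LBSMReduction

/-- The vertex set `{r} ∪ U ∪ V ∪ W` of the constructed graph, where `U = Fin m`,
`V = Fin p`, and `W = ⋃_i W_i` with `W_i ≃ Fin (w(u_i) − 1)`. -/
abbrev LBSMVert (m p : ℕ) (w : Fin m → ℕ) : Type :=
  Unit ⊕ Fin m ⊕ Fin p ⊕ (Σ i : Fin m, Fin (w i - 1))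

/-- The adjacency generator of the constructed graph: the edges of the bipartite graph `H`
between `U` and `V`, the edges `{r, v_j}`, and the edges `{u_i, w_{i,j}}`. -/
def lbsmRel (m p : ℕ) (w : Fin m → ℕ) (E : Fin m → Fin p → Prop) :
    LBSMVert m p w → LBSMVert m p w → Prop
  | Sum.inl _, Sum.inr (Sum.inr (Sum.inl _)) => True
  | Sum.inr (Sum.inl i), Sum.inr (Sum.inr (Sum.inl j)) => E i j
  | Sum.inr (Sum.inl i), Sum.inr (Sum.inr (Sum.inr ⟨i', _⟩)) => i = i'
  | _, _ => False

/-- The constructed graph `G'`. -/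
def lbsmGraph (m p : ℕ) (w : Fin m → ℕ) (E : Fin m → Fin p → Prop) :
    SimpleGraph (LBSMVert m p w) :=
  SimpleGraph.fromRel (lbsmRel m p w E)

/-- Report sizes: every vertex of `U ∪ V ∪ W` has report size 1, and `r` has report size 0. -/
def lbsmSize (m p : ℕ) (w : Fin m → ℕ) : LBSMVert m p w → ℕ
  | Sum.inl _ => 0
  | _ => 1

namespace RoutingTree

variable {X : Type*} {G : SimpleGraph X} {r : X}

/-- `T.Below u v` means that the tree path from `u` to the root passes through `v`. -/
def Below (T : RoutingTree G r) (u v : X) : Prop :=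
  ∃ n, T.parent^[n] u = v

theorem below_iff (T : RoutingTree G r) (u v : X) :
    T.Below u v ↔ u = v ∨ T.Below (T.parent u) v := by
  constructor
  · rintro ⟨n, hn⟩
    cases n with
    | zero => exact Or.inl hn
    | succ n => exact Or.inr ⟨n, hn⟩
  · rintro (h | ⟨n, hn⟩)
    · exact ⟨0, h⟩
    · exact ⟨n + 1, hn⟩

theorem below_refl (T : RoutingTree G r) (v : X) : T.Below v v := ⟨0, rfl⟩

theorem below_root_iff (T : RoutingTree G r) (v : X) : T.Below r v ↔ r = v := by
  refine ⟨?_, fun h => ⟨0, h⟩⟩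
  rintro ⟨n, hn⟩
  rwa [Function.iterate_fixed T.parent_root] at hn

theorem eq_root_of_parent_parent (T : RoutingTree G r) {v : X}
    (h : T.parent (T.parent v) = v) : v = r := by
  have key : ∀ n, T.parent^[n] v = v ∨ T.parent^[n] v = T.parent v := by
    intro n
    induction n with
    | zero => exact Or.inl rfl
    | succ n ih =>
      rw [Function.iterate_succ_apply']
      rcases ih with ih | ih <;> simp [ih, h]
  obtain ⟨n, hn⟩ := T.reaches v
  rcases key n with h' | h'
  · rw [← h', hn]
  · rw [← h, ← h', hn, T.parent_root]

open scoped Classical in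
theorem des_add_size [Fintype X] [DecidableEq X] (s : X → ℕ) (T : RoutingTree G r) (v : X) :
    des s T v + s v = ∑ u, if T.Below u v then s u else 0 := by
  have hs : s v = ∑ u, if u = v then s u else 0 := by simp
  rw [des]
  rw [hs, ← Finset.sum_add_distrib]
  refine Finset.sum_congr rfl fun u _ => ?_
  by_cases huv : u = v
  · subst huv
    simp [T.below_refl]
  · simp only [ne_eq, huv, not_false_eq_true, true_and, if_false, add_zero, Below]
    congr

end RoutingTree

section LBSMTree

variable {m p : ℕ} {w : Fin m → ℕ} {E : Fin m → Fin p → Prop}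

/-- The vertex `u_i`. -/
abbrev lbsmU (i : Fin m) : LBSMVert m p w := Sum.inr (Sum.inl i)

/-- The vertex `v_j`. -/
abbrev lbsmV (j : Fin p) : LBSMVert m p w := Sum.inr (Sum.inr (Sum.inl j))

/-- The vertex `w_{i,a}`. -/
abbrev lbsmW (x : Σ i : Fin m, Fin (w i - 1)) : LBSMVert m p w := Sum.inr (Sum.inr (Sum.inr x))

theorem lbsm_parent_W (T : RoutingTree (lbsmGraph m p w E) (Sum.inl ()))
    (x : Σ i : Fin m, Fin (w i - 1)) : T.parent (lbsmW x) = lbsmU x.1 := by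
  have h := T.adj (lbsmW x) (by simp)
  generalize T.parent (lbsmW x) = y at h
  rcases y with _ | i | j | y <;> simp_all [lbsmGraph, SimpleGraph.fromRel_adj, lbsmRel]

theorem lbsm_exists_parent_U (T : RoutingTree (lbsmGraph m p w E) (Sum.inl ())) (i : Fin m) :
    ∃ j, E i j ∧ T.parent (lbsmU i) = lbsmV j := by
  have h := T.adj (lbsmU i) (by simp)
  have h2 : T.parent (T.parent (lbsmU i)) ≠ lbsmU i := fun h' => by
    simpa using T.eq_root_of_parent_parent h'
  generalize T.parent (lbsmU i) = y at h h2
  rcases y with _ | i' | j | y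
  · simp [lbsmGraph, SimpleGraph.fromRel_adj, lbsmRel] at h
  · simp [lbsmGraph, SimpleGraph.fromRel_adj, lbsmRel] at h
  · exact ⟨j, by simpa [lbsmGraph, SimpleGraph.fromRel_adj, lbsmRel] using h, rfl⟩
  · rw [lbsm_parent_W T y] at h2
    simp_all [lbsmGraph, SimpleGraph.fromRel_adj, lbsmRel]

open scoped Classical in
theorem lbsm_load_eq (T : RoutingTree (lbsmGraph m p w E) (Sum.inl ())) (x : LBSMVert m p w) :
    des (lbsmSize m p w) T x + lbsmSize m p w x =
      (∑ i, if T.Below (lbsmU i) x then 1 else 0) +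
      ((∑ j, if T.Below (lbsmV j) x then 1 else 0) +
      ∑ i, ∑ a : Fin (w i - 1), if T.Below (lbsmW ⟨i, a⟩) x then 1 else 0) := by
  rw [T.des_add_size]
  simp only [Fintype.sum_sum_type, Fintype.sum_sigma, lbsmSize, ite_self, Finset.sum_const_zero,
    zero_add]

theorem lbsm_le_load_U (T : RoutingTree (lbsmGraph m p w E) (Sum.inl ())) (i : Fin m) :
    (w i - 1) + 1 ≤ des (lbsmSize m p w) T (lbsmU i) + lbsmSize m p w (lbsmU i) := by
  classical
  have h1 : 1 ≤ ∑ i', if T.Below (lbsmU i') (lbsmU i) then 1 else 0 := by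
    refine le_trans ?_ (Finset.single_le_sum (fun _ _ => Nat.zero_le _) (Finset.mem_univ i))
    simp [T.below_refl]
  have h2 : w i - 1 ≤ ∑ i', ∑ a : Fin (w i' - 1),
      if T.Below (lbsmW ⟨i', a⟩) (lbsmU i) then 1 else 0 := by
    refine le_trans ?_ (Finset.single_le_sum (fun _ _ => Nat.zero_le _) (Finset.mem_univ i))
    simp [T.below_iff (lbsmW _), lbsm_parent_W, T.below_refl]
  rw [lbsm_load_eq]
  omega

theorem lbsm_sum_weight_add_one_eq (hw : ∀ i, 1 ≤ w i) (M : Fin m → Fin p) (j : Fin p) :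
    (∑ i with M i = j, w i) + 1 =
      (∑ i, if M i = j then 1 else 0) + ((∑ j', if j' = j then 1 else 0) +
        ∑ i, ∑ _a : Fin (w i - 1), if M i = j then 1 else 0) := by
  have h : ∑ i with M i = j, w i = (∑ i, if M i = j then 1 else 0) +
      ∑ i, ∑ _a : Fin (w i - 1), if M i = j then 1 else 0 := by
    rw [Finset.sum_filter, ← Finset.sum_add_distrib]
    refine Finset.sum_congr rfl fun i _ => ?_
    have := hw i
    split_ifs <;> simp
    omega
  rw [h]
  simp
  omega

theorem lbsm_le_load_V (T : RoutingTree (lbsmGraph m p w E) (Sum.inl ()))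
    (hw : ∀ i, 1 ≤ w i) {M : Fin m → Fin p}
    (hM : ∀ i, T.parent (lbsmU i) = lbsmV (M i)) (j : Fin p) :
    (∑ i with M i = j, w i) + 1 ≤
      des (lbsmSize m p w) T (lbsmV j) + lbsmSize m p w (lbsmV j) := by
  classical
  have hU : ∀ i, M i = j → T.Below (lbsmU i) (lbsmV j) := fun i h => by
    rw [T.below_iff, hM, h]
    exact Or.inr (T.below_refl _)
  have hW : ∀ x, M x.1 = j → T.Below (lbsmW x) (lbsmV j) := fun x h => by
    rw [T.below_iff, lbsm_parent_W]
    exact Or.inr (hU _ h)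
  have ite_le : ∀ {a b : Prop} [Decidable a] [Decidable b], (a → b) →
      (if a then 1 else 0 : ℕ) ≤ if b then 1 else 0 := by
    intro a b _ _ h
    split_ifs <;> simp_all
  rw [lbsm_load_eq, lbsm_sum_weight_add_one_eq hw]
  gcongr with i _ j' _ i _ a _
  · exact ite_le (hU i)
  · exact ite_le fun h => h ▸ T.below_refl _
  · exact ite_le (hW ⟨i, a⟩)

theorem lbsm_cost_eq (k : ℕ) (T : RoutingTree (lbsmGraph m p w E) (Sum.inl ())) (g : ℕ → ℝ)
    (hg : ∀ n : ℕ, g n = (⌈(n : ℝ) / ((k : ℝ) + 1)⌉ : ℝ)) :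
    cost (lbsmSize m p w) (k + 1) 1 1 T = 2 *
      ((∑ i, ∑ a : Fin (w i - 1),
          g (des (lbsmSize m p w) T (lbsmW ⟨i, a⟩) + lbsmSize m p w (lbsmW ⟨i, a⟩))) +
        (∑ i, g (des (lbsmSize m p w) T (lbsmU i) + lbsmSize m p w (lbsmU i))) +
        ∑ j, g (des (lbsmSize m p w) T (lbsmV j) + lbsmSize m p w (lbsmV j))) := by
  simp only [cost, hg]
  rw [Finset.sum_erase_eq_sub (Finset.mem_univ _)]
  simp only [Fintype.sum_sum_type, Fintype.sum_sigma, Finset.univ_unique, Finset.sum_singleton]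
  push_cast
  simp only [PUnit.default_eq_unit]
  ring

/-- The parent map sending `v_j` to `r`, `u_i` to `v_{M i}` and `w_{i,a}` to `u_i`. -/
def lbsmParent (w : Fin m → ℕ) (M : Fin m → Fin p) : LBSMVert m p w → LBSMVert m p w
  | Sum.inl _ => Sum.inl ()
  | Sum.inr (Sum.inl i) => lbsmV (M i)
  | Sum.inr (Sum.inr (Sum.inl _)) => Sum.inl ()
  | Sum.inr (Sum.inr (Sum.inr x)) => lbsmU x.1

/-- The routing tree of a semi-matching. -/
def lbsmTree (w : Fin m → ℕ) (M : Fin m → Fin p) (hM : ∀ i, E i (M i)) :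
    RoutingTree (lbsmGraph m p w E) (Sum.inl ()) where
  parent := lbsmParent w M
  parent_root := rfl
  adj := by
    rintro (_ | i | j | x) h
    · exact absurd rfl h
    all_goals simp [lbsmGraph, SimpleGraph.fromRel_adj, lbsmRel, lbsmParent, hM]
  reaches v := ⟨3, by rcases v with _ | i | j | x <;> rfl⟩

theorem lbsmTree_below_V (M : Fin m → Fin p) (hM : ∀ i, E i (M i)) (j : Fin p)
    (x : LBSMVert m p w) :
    (lbsmTree w M hM).Below (lbsmV j) x ↔ lbsmV j = x ∨ Sum.inl () = x := by
  rw [RoutingTree.below_iff, ← (lbsmTree w M hM).below_root_iff]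
  rfl

theorem lbsmTree_below_U (M : Fin m → Fin p) (hM : ∀ i, E i (M i)) (i : Fin m)
    (x : LBSMVert m p w) :
    (lbsmTree w M hM).Below (lbsmU i) x ↔ lbsmU i = x ∨ lbsmV (M i) = x ∨ Sum.inl () = x := by
  rw [RoutingTree.below_iff, ← lbsmTree_below_V M hM]
  rfl

theorem lbsmTree_below_W (M : Fin m → Fin p) (hM : ∀ i, E i (M i))
    (y : Σ i : Fin m, Fin (w i - 1)) (x : LBSMVert m p w) :
    (lbsmTree w M hM).Below (lbsmW y) x ↔
      lbsmW y = x ∨ lbsmU y.1 = x ∨ lbsmV (M y.1) = x ∨ Sum.inl () = x := by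
  rw [RoutingTree.below_iff, ← lbsmTree_below_U M hM]
  rfl

theorem lbsmTree_load_U (M : Fin m → Fin p) (hM : ∀ i, E i (M i)) (i : Fin m) :
    des (lbsmSize m p w) (lbsmTree w M hM) (lbsmU i) + lbsmSize m p w (lbsmU i) =
      (w i - 1) + 1 := by
  rw [lbsm_load_eq]
  simp [lbsmTree_below_U, lbsmTree_below_V, lbsmTree_below_W, add_comm]

theorem lbsmTree_load_V (M : Fin m → Fin p) (hM : ∀ i, E i (M i)) (hw : ∀ i, 1 ≤ w i)
    (j : Fin p) :
    des (lbsmSize m p w) (lbsmTree w M hM) (lbsmV j) + lbsmSize m p w (lbsmV j) =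
      (∑ i with M i = j, w i) + 1 := by
  rw [lbsm_load_eq, lbsm_sum_weight_add_one_eq hw]
  simp [lbsmTree_below_U, lbsmTree_below_V, lbsmTree_below_W]

theorem lbsmTree_load_W (M : Fin m → Fin p) (hM : ∀ i, E i (M i))
    (x : Σ i : Fin m, Fin (w i - 1)) :
    des (lbsmSize m p w) (lbsmTree w M hM) (lbsmW x) + lbsmSize m p w (lbsmW x) = 1 := by
  classical
  rw [lbsm_load_eq, ← Fintype.sum_sigma (fun y : Σ i : Fin m, Fin (w i - 1) =>
    if (lbsmTree w M hM).Below (lbsmW y) (lbsmW x) then 1 else 0)]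
  simp [lbsmTree_below_U, lbsmTree_below_V, lbsmTree_below_W]

end LBSMTree

/-- The LBSM problem reduces to the MECAT problem: the bipartite graph `H` (with parts
`Fin m` and `Fin p`, edge relation `E`, and weights `w`) has a semi-matching `M` with
`max_{v} Σ_{u ∈ Adj_M(v)} w(u) ≤ k` if and only if the constructed graph `G'` has a routing
tree of energy cost at most `C = 2(|W| + Σ_i ⌈(|W_i|+1)/q⌉ + |V|)`, where `q = k+1` and
`Tx = Rx = 1`. -/
theorem lbsm_reduces_to_mecat (m p k : ℕ) (hk : 1 ≤ k)
    (E : Fin m → Fin p → Prop) (w : Fin m → ℕ) (hw : ∀ i, 1 ≤ w i) :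
    (∃ M : Fin m → Fin p, (∀ i, E i (M i)) ∧
        ∀ j : Fin p, ∑ i ∈ Finset.univ.filter (fun i => M i = j), w i ≤ k) ↔
      (∃ T : RoutingTree (lbsmGraph m p w E) (Sum.inl ()),
        cost (lbsmSize m p w) (k + 1) 1 1 T ≤
          2 * ((∑ i : Fin m, ((w i - 1 : ℕ) : ℝ)) +
            (∑ i : Fin m, (⌈(((w i - 1) + 1 : ℕ) : ℝ) / ((k : ℝ) + 1)⌉ : ℝ)) +
            (p : ℝ))) := by
  set g : ℕ → ℝ := fun n => (⌈(n : ℝ) / ((k : ℝ) + 1)⌉ : ℝ) with hg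
  have hk0 : (0 : ℝ) < (k : ℝ) + 1 := by positivity
  have g_mono : Monotone g := fun a b hab => by
    simp only [hg]
    gcongr
  have one_le_g : ∀ n, 1 ≤ n → 1 ≤ g n := fun n hn => by
    have : (0 : ℝ) < n := by exact_mod_cast hn
    have h : 0 < ⌈(n : ℝ) / ((k : ℝ) + 1)⌉ := Int.ceil_pos.2 (by positivity)
    exact Int.cast_one_le_of_pos h
  have g_le_one : ∀ n, g n ≤ 1 ↔ n ≤ k + 1 := fun n => by
    have h : g n ≤ 1 ↔ ⌈(n : ℝ) / ((k : ℝ) + 1)⌉ ≤ 1 := by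
      simp only [hg]
      exact_mod_cast Iff.rfl
    rw [h, Int.ceil_le, Int.cast_one, div_le_one hk0]
    exact_mod_cast Iff.rfl
  constructor
  · rintro ⟨M, hM, hload⟩
    refine ⟨lbsmTree w M hM, ?_⟩
    rw [lbsm_cost_eq k _ g fun _ => rfl]
    simp only [lbsmTree_load_U, lbsmTree_load_V M hM hw, lbsmTree_load_W]
    have hW : ∑ i, ∑ _a : Fin (w i - 1), g 1 ≤ ∑ i, ((w i - 1 : ℕ) : ℝ) := by
      refine Finset.sum_le_sum fun i _ => ?_
      refine (Finset.sum_le_card_nsmul _ _ 1 fun _ _ => (g_le_one 1).2 (by omega)).trans ?_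
      simp
    have hV : ∑ j, g ((∑ i with M i = j, w i) + 1) ≤ p := by
      refine (Finset.sum_le_card_nsmul _ _ 1 fun j _ => (g_le_one _).2 ?_).trans (by simp)
      exact Nat.succ_le_succ (hload j)
    gcongr
  · rintro ⟨T, hT⟩
    choose M hE hM using lbsm_exists_parent_U T
    refine ⟨M, hE, fun j => ?_⟩
    rw [lbsm_cost_eq k T g fun _ => rfl] at hT
    have hW : ∑ i, ((w i - 1 : ℕ) : ℝ) ≤ ∑ i, ∑ a : Fin (w i - 1),
        g (des (lbsmSize m p w) T (lbsmW ⟨i, a⟩) + lbsmSize m p w (lbsmW ⟨i, a⟩)) := by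
      refine Finset.sum_le_sum fun i _ => ?_
      refine le_trans ?_ (Finset.card_nsmul_le_sum _ _ 1 fun _ _ => one_le_g _ ?_)
      · simp
      · simp [lbsmSize]
    have hU : ∑ i, g ((w i - 1) + 1) ≤
        ∑ i, g (des (lbsmSize m p w) T (lbsmU i) + lbsmSize m p w (lbsmU i)) :=
      Finset.sum_le_sum fun i _ => g_mono (lbsm_le_load_U T i)
    have hV : ∀ j, 1 ≤ g (des (lbsmSize m p w) T (lbsmV j) + lbsmSize m p w (lbsmV j)) :=
      fun j => one_le_g _ (by simp [lbsmSize])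
    have hsum : ∑ j, (g (des (lbsmSize m p w) T (lbsmV j) + lbsmSize m p w (lbsmV j)) - 1) ≤ 0 := by
      simp only [Finset.sum_sub_distrib, Finset.sum_const, Finset.card_univ, Fintype.card_fin,
        nsmul_eq_mul, mul_one]
      linarith
    have hj := (Finset.single_le_sum (fun j' _ => sub_nonneg.2 (hV j'))
      (Finset.mem_univ j)).trans hsum
    have hle := (g_le_one _).1 (sub_nonpos.1 hj)
    have := lbsm_le_load_V T hw hM j
    omega

end LBSMReduction
end

section
/- Let H be a finite simple graph with vertex set {v_1,…,v_n}, n ≥ 1, and maximum degree Δ(H), and let k ∈ ℕ with k ≥ 1. Construct the graph G' on vertex set {r} ∪ W ∪ U, where W = {w_1,…,w_n} and U = {u_1,…,u_n}, with edges {r,w_i} for all 1 ≤ i ≤ n, {w_i,u_i} for all 1 ≤ i ≤ n, and {w_i,u_j} whenever {v_i,v_j} is an edge of H. Take U as the set of sources with s(u) = 1 for u ∈ U and s(v) = 0 for all other vertices, and set q = Δ(H)+1, Tx = Rx = 1, and C = 2(n+k). Then H has a dominating set of size at most k if and only if G' has a routing tree with relay nodes (a subtree of G' rooted at r whose vertex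 set contains U ∪ {r}) of energy cost at most C. -/
open Finset

variable {V : Type*} [Fintype V] [DecidableEq V]

/-- A routing tree with relay nodes for a network `G` with sink `r` and source set `U`:
a subtree of `G` rooted at `r` whose vertex set contains `U ∪ {r}`. Every vertex `v ≠ r`
of the tree has a unique parent adjacent to it in `G`, and iterating parents reaches `r`. -/
structure RelayTree (G : SimpleGraph V) (r : V) (U : Finset V) where
  verts : Finset V
  root_mem : r ∈ verts
  source_subset : U ⊆ verts
  parent : V → V
  parent_mem : ∀ v ∈ verts, parent v ∈ verts
  parent_root : parent r = r
  adj : ∀ v ∈ verts, v ≠ r → G.Adj v (parent v)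
  reaches : ∀ v ∈ verts, ∃ n, parent^[n] v = r

open scoped Classical in
/-- `desR s T v`: the total size of reports of the proper descendants of `v` in `T`,
i.e. of the vertices `u ≠ v` of `T` whose tree path to the root passes through `v`. -/
noncomputable def desR {G : SimpleGraph V} {r : V} {U : Finset V} (s : V → ℕ)
    (T : RelayTree G r U) (v : V) : ℕ :=
  ∑ u ∈ T.verts, if u ≠ v ∧ (∃ n, T.parent^[n] u = v) then s u else 0

/-- The energy cost of a routing tree with relay nodes:
`COST(T) = (Tx+Rx) · Σ_{v ∈ V(T), v ≠ r} ⌈(des_T(v)+s(v))/q⌉`. -/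
noncomputable def costR {G : SimpleGraph V} {r : V} {U : Finset V} (s : V → ℕ) (q : ℕ)
    (Tx Rx : ℝ) (T : RelayTree G r U) : ℝ :=
  (Tx + Rx) * ∑ v ∈ T.verts.erase r, (⌈(((desR s T v + s v : ℕ) : ℝ) / (q : ℝ))⌉ : ℝ)

/-- The hop distance from `v` to the root `r` in the tree `T`. -/
noncomputable def relayDist {G : SimpleGraph V} {r : V} {U : Finset V}
    (T : RelayTree G r U) (v : V) : ℕ :=
  sInf {n : ℕ | T.parent^[n] v = r}

/-- The minimum number of edges of a connected subgraph of `G` containing `U ∪ {r}`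
(the number of edges of a minimum Steiner tree for `U ∪ {r}`). -/
noncomputable def steinerEdges (G : SimpleGraph V) (U : Finset V) (r : V) : ℕ :=
  sInf {k : ℕ | ∃ H : G.Subgraph, H.Connected ∧ (↑U ∪ {r} : Set V) ⊆ H.verts ∧
    H.edgeSet.ncard = k}

section DSReduction

/-- The vertex set `{r} ∪ W ∪ U` of the constructed graph, where `W` and `U` are copies of
the vertex set `Fin n` of `H`. -/
abbrev DSVert (n : ℕ) : Type := Unit ⊕ Fin n ⊕ Fin n

/-- The adjacency generator of the constructed graph: edges `{r, w_i}`, `{w_i, u_i}`, and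
`{w_i, u_j}` whenever `{v_i, v_j}` is an edge of `H`. -/
def dsRel (n : ℕ) (H : SimpleGraph (Fin n)) : DSVert n → DSVert n → Prop
  | Sum.inl _, Sum.inr (Sum.inl _) => True
  | Sum.inr (Sum.inl i), Sum.inr (Sum.inr j) => i = j ∨ H.Adj i j
  | _, _ => False

/-- The constructed graph `G'`. -/
def dsGraph (n : ℕ) (H : SimpleGraph (Fin n)) : SimpleGraph (DSVert n) :=
  SimpleGraph.fromRel (dsRel n H)

/-- The set of sources: the copy `U` of the vertices of `H`. -/
def dsSources (n : ℕ) : Finset (DSVert n) :=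
  Finset.univ.image (fun i => Sum.inr (Sum.inr i))

/-- Report sizes: `s(u) = 1` for sources `u ∈ U` and `s(v) = 0` for all other vertices. -/
def dsSize (n : ℕ) : DSVert n → ℕ
  | Sum.inr (Sum.inr _) => 1
  | _ => 0

lemma le_desR_of_parent_eq {α : Type*} [DecidableEq α] {G : SimpleGraph α} {r : α}
    {U : Finset α} (s : α → ℕ) (T : RelayTree G r U) {u v : α} (hu : u ∈ T.verts) (huv : u ≠ v)
    (hp : T.parent u = v) : s u ≤ desR s T v := by
  classical
  have h := Finset.single_le_sum
    (f := fun x => if x ≠ v ∧ (∃ n, T.parent^[n] x = v) then s x else 0)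
    (fun x _ => Nat.zero_le _) hu
  have hc : u ≠ v ∧ ∃ n, T.parent^[n] u = v := ⟨huv, 1, hp⟩
  simp only [if_pos hc] at h
  unfold desR
  convert h

/-- If every vertex of a set `S` of non-root tree vertices sends at least one report, the cost is
at least `(Tx + Rx) * |S|`. -/
lemma card_mul_le_costR {α : Type*} [DecidableEq α] {G : SimpleGraph α} {r : α}
    {U : Finset α} (s : α → ℕ) {q : ℕ} (hq : 0 < q) {Tx Rx : ℝ} (hTR : 0 ≤ Tx + Rx)
    (T : RelayTree G r U) {S : Finset α} (hS : S ⊆ T.verts.erase r)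
    (hpos : ∀ v ∈ S, 0 < desR s T v + s v) : (Tx + Rx) * (S.card : ℝ) ≤ costR s q Tx Rx T := by
  unfold costR
  refine mul_le_mul_of_nonneg_left ?_ hTR
  calc (S.card : ℝ) = ∑ _v ∈ S, (1 : ℝ) := by simp
    _ ≤ ∑ v ∈ S, (⌈(((desR s T v + s v : ℕ) : ℝ) / (q : ℝ))⌉ : ℝ) := by
        refine Finset.sum_le_sum fun v hv => ?_
        have h : 0 < (((desR s T v + s v : ℕ) : ℝ) / (q : ℝ)) :=
          div_pos (Nat.cast_pos.mpr (hpos v hv)) (Nat.cast_pos.mpr hq)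
        exact_mod_cast Int.one_le_ceil_iff.mpr h
    _ ≤ _ := by
        refine Finset.sum_le_sum_of_subset_of_nonneg hS fun v _ _ => ?_
        have h : 0 ≤ (((desR s T v + s v : ℕ) : ℝ) / (q : ℝ)) := by positivity
        exact_mod_cast Int.ceil_nonneg h

/-- If every non-root tree vertex forwards at most `q` reports, the cost is at most
`(Tx + Rx)` times the number of non-root tree vertices. -/
lemma costR_le_mul_card {α : Type*} [DecidableEq α] {G : SimpleGraph α} {r : α}
    {U : Finset α} (s : α → ℕ) {q : ℕ} (hq : 0 < q) {Tx Rx : ℝ} (hTR : 0 ≤ Tx + Rx)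
    (T : RelayTree G r U) (hle : ∀ v ∈ T.verts.erase r, desR s T v + s v ≤ q) :
    costR s q Tx Rx T ≤ (Tx + Rx) * ((T.verts.erase r).card : ℝ) := by
  unfold costR
  refine mul_le_mul_of_nonneg_left ?_ hTR
  calc _ ≤ ∑ _v ∈ T.verts.erase r, (1 : ℝ) := by
        refine Finset.sum_le_sum fun v hv => ?_
        have h : (((desR s T v + s v : ℕ) : ℝ) / (q : ℝ)) ≤ 1 :=
          (div_le_one (Nat.cast_pos.mpr hq)).mpr (Nat.cast_le.mpr (hle v hv))
        have h' : ⌈(((desR s T v + s v : ℕ) : ℝ) / (q : ℝ))⌉ ≤ 1 :=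
          Int.ceil_le.mpr (by simpa using h)
        exact_mod_cast h'
    _ = _ := by simp

lemma dsGraph_adj_source {n : ℕ} {H : SimpleGraph (Fin n)} {j : Fin n} {x : DSVert n}
    (h : (dsGraph n H).Adj (Sum.inr (Sum.inr j)) x) :
    ∃ i, x = Sum.inr (Sum.inl i) ∧ (i = j ∨ H.Adj i j) := by
  rcases x with _ | i | i <;> simp_all [dsGraph, dsRel]

/-- The parent map sending each source `u_j` to the relay `w_{f j}` and each relay to the sink. -/
def dsParent {n : ℕ} (f : Fin n → Fin n) : DSVert n → DSVert n
  | Sum.inr (Sum.inr j) => Sum.inr (Sum.inl (f j))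
  | _ => Sum.inl ()

lemma dsParent_dsParent {n : ℕ} (f : Fin n → Fin n) (x : DSVert n) :
    dsParent f (dsParent f x) = Sum.inl () := by
  rcases x with _ | i | i <;> rfl

lemma dsParent_iterate_add_two {n : ℕ} (f : Fin n → Fin n) (m : ℕ) (x : DSVert n) :
    (dsParent f)^[m + 2] x = Sum.inl () := by
  rw [Function.iterate_add_apply]
  change (dsParent f)^[m] (dsParent f (dsParent f x)) = _
  rw [dsParent_dsParent]
  exact Function.iterate_fixed rfl m

/-- A vertex below a non-root vertex `v` in the tree of `dsParent f` is a child of `v`. -/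
lemma dsParent_eq_of_iterate_eq {n : ℕ} {f : Fin n → Fin n} {m : ℕ} {x v : DSVert n}
    (hv : v ≠ Sum.inl ()) (hxv : x ≠ v) (h : (dsParent f)^[m] x = v) : dsParent f x = v := by
  match m, h with
  | 0, h => exact absurd h hxv
  | 1, h => exact h
  | m + 2, h => exact absurd ((dsParent_iterate_add_two f m x).symm.trans h).symm hv

/-- The routing tree in which the source `u_j` is attached to the sink through the relay
`w_{f j}`, where `f j` dominates `j`. -/
def dsTree {n : ℕ} (H : SimpleGraph (Fin n)) (f : Fin n → Fin n)
    (hf : ∀ j, f j = j ∨ H.Adj (f j) j) :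
    RelayTree (dsGraph n H) (Sum.inl ()) (dsSources n) where
  verts := insert (Sum.inl ())
    ((Finset.univ.image f).image (fun i => Sum.inr (Sum.inl i)) ∪ dsSources n)
  root_mem := by simp
  source_subset := fun x hx => by simp [hx]
  parent := dsParent f
  parent_mem := fun v _ => by rcases v with _ | i | i <;> simp [dsParent]
  parent_root := rfl
  adj := fun v _ hvr => by
    rcases v with _ | i | j
    · exact absurd rfl hvr
    · simp [dsGraph, dsRel, dsParent]
    · simpa [dsGraph, dsRel, dsParent] using hf j
  reaches := fun v _ => ⟨2, dsParent_iterate_add_two f 0 v⟩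

lemma desR_dsTree_le {n : ℕ} (H : SimpleGraph (Fin n)) (f : Fin n → Fin n)
    (hf : ∀ j, f j = j ∨ H.Adj (f j) j) {v : DSVert n} (hv : v ≠ Sum.inl ()) :
    desR (dsSize n) (dsTree H f hf) v ≤
      (Finset.univ.filter fun j => Sum.inr (Sum.inl (f j)) = v).card := by
  classical
  unfold desR
  calc _ ≤ ∑ u : DSVert n, if dsParent f u = v then dsSize n u else 0 := by
        refine (Finset.sum_le_sum fun u _ => ?_).trans
          (Finset.sum_le_sum_of_subset (Finset.subset_univ _))
        split_ifs with h1 h2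
        · exact le_rfl
        · exact absurd (dsParent_eq_of_iterate_eq hv h1.1 h1.2.choose_spec) h2
        · exact Nat.zero_le _
        · exact le_rfl
    _ = _ := by
        have h : ∀ u : DSVert n, (if dsParent f u = v then dsSize n u else 0) =
            Sum.elim (fun _ => 0) (Sum.elim (fun _ => 0) fun j =>
              if Sum.inr (Sum.inl (f j)) = v then 1 else 0) u := by
          rintro (_ | i | j)
          · exact ite_self 0
          · exact ite_self 0
          · rfl
        simp [h, Fintype.sum_sum_type]

lemma desR_dsTree_add_dsSize_le {n : ℕ} (H : SimpleGraph (Fin n)) [DecidableRel H.Adj]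
    (f : Fin n → Fin n) (hf : ∀ j, f j = j ∨ H.Adj (f j) j) {v : DSVert n}
    (hv : v ≠ Sum.inl ()) :
    desR (dsSize n) (dsTree H f hf) v + dsSize n v ≤ H.maxDegree + 1 := by
  have h := desR_dsTree_le H f hf hv
  rcases v with _ | i | j
  · exact absurd rfl hv
  · have hsub : (Finset.univ.filter fun j => (Sum.inr (Sum.inl (f j)) : DSVert n) =
        Sum.inr (Sum.inl i)) ⊆ insert i (H.neighborFinset i) := by
      intro j hj
      have hj' : f j = i := by simpa using hj
      have := hf j
      rw [hj'] at this
      rcases this with rfl | h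
      · simp
      · simp [h]
    have h1 := (Finset.card_le_card hsub).trans (Finset.card_insert_le _ _)
    rw [H.card_neighborFinset_eq_degree] at h1
    have h2 := H.degree_le_maxDegree i
    simp only [dsSize]
    omega
  · have h0 : desR (dsSize n) (dsTree H f hf) (Sum.inr (Sum.inr j)) = 0 := by simpa using h
    simp [h0, dsSize]

lemma card_relays_union_dsSources {n : ℕ} (D : Finset (Fin n)) :
    (D.image (fun i => (Sum.inr (Sum.inl i) : DSVert n)) ∪ dsSources n).card = D.card + n := by
  rw [Finset.card_union_of_disjoint, Finset.card_image_of_injective, dsSources,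
    Finset.card_image_of_injective, Finset.card_univ, Fintype.card_fin]
  · exact Sum.inr_injective.comp Sum.inr_injective
  · exact Sum.inr_injective.comp Sum.inl_injective
  · simp [Finset.disjoint_left, dsSources]

/-- The Dominating Set problem reduces to the MECAT_RN problem: `H` (a graph on `n ≥ 1`
vertices) has a dominating set of size at most `k` if and only if the constructed graph
`G'` has a routing tree with relay nodes of energy cost at most `C = 2(n+k)`, where
`q = Δ(H)+1` and `Tx = Rx = 1`. -/
theorem ds_reduces_to_mecat_rn (n k : ℕ) (hn : 1 ≤ n) (hk : 1 ≤ k)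
    (H : SimpleGraph (Fin n)) [DecidableRel H.Adj] :
    (∃ D : Finset (Fin n), D.card ≤ k ∧ ∀ v : Fin n, v ∈ D ∨ ∃ d ∈ D, H.Adj v d) ↔
      (∃ T : RelayTree (dsGraph n H) (Sum.inl ()) (dsSources n),
        costR (dsSize n) (H.maxDegree + 1) 1 1 T ≤ 2 * ((n : ℝ) + (k : ℝ))) := by
  constructor
  · rintro ⟨D, hDk, hD⟩
    have hex : ∀ j, ∃ i ∈ D, i = j ∨ H.Adj i j := fun j =>
      (hD j).elim (fun h => ⟨j, h, Or.inl rfl⟩) fun ⟨d, hd, h⟩ => ⟨d, hd, Or.inr h.symm⟩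
    choose f hfD hf using hex
    refine ⟨dsTree H f hf, ?_⟩
    have hcost := costR_le_mul_card (dsSize n) (Nat.succ_pos H.maxDegree)
      (by norm_num : (0 : ℝ) ≤ 1 + 1) (dsTree H f hf) fun v hv =>
        desR_dsTree_add_dsSize_le H f hf (Finset.ne_of_mem_erase hv)
    have hcard : ((dsTree H f hf).verts.erase (Sum.inl ())).card ≤ n + k := by
      have h1 := Finset.card_le_card (Finset.erase_insert_subset (Sum.inl ())
        ((Finset.univ.image f).image (fun i => (Sum.inr (Sum.inl i) : DSVert n)) ∪ dsSources n))
      rw [card_relays_union_dsSources] at h1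
      have h2 : (Finset.univ.image f).card ≤ D.card :=
        Finset.card_le_card (Finset.image_subset_iff.mpr fun j _ => hfD j)
      change (Finset.erase (insert _ _) _).card ≤ _
      omega
    have hcard' : (((dsTree H f hf).verts.erase (Sum.inl ())).card : ℝ) ≤ n + k := by
      exact_mod_cast hcard
    refine hcost.trans ?_
    linarith
  · rintro ⟨T, hT⟩
    have hu : ∀ j, (Sum.inr (Sum.inr j) : DSVert n) ∈ T.verts := fun j =>
      T.source_subset (by simp [dsSources])
    choose f hfp hf using fun j => dsGraph_adj_source (T.adj _ (hu j) (by simp))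
    refine ⟨Finset.univ.image f, ?_, fun v => ?_⟩
    · have hcost := card_mul_le_costR (dsSize n) (Nat.succ_pos H.maxDegree)
        (by norm_num : (0 : ℝ) ≤ 1 + 1) T
        (S := (Finset.univ.image f).image (fun i => (Sum.inr (Sum.inl i) : DSVert n)) ∪
          dsSources n) ?_ ?_
      · rw [card_relays_union_dsSources] at hcost
        have h := hcost.trans hT
        push_cast at h
        have h' : ((Finset.univ.image f).card : ℝ) ≤ k := by linarith
        exact_mod_cast h'
      · intro x hx
        simp only [dsSources, Finset.mem_union, Finset.mem_image, Finset.mem_univ, true_and,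
          exists_exists_eq_and] at hx
        rcases hx with ⟨j, rfl⟩ | ⟨j, rfl⟩
        · exact Finset.mem_erase.mpr ⟨by simp, hfp j ▸ T.parent_mem _ (hu j)⟩
        · exact Finset.mem_erase.mpr ⟨by simp, hu j⟩
      · intro x hx
        simp only [dsSources, Finset.mem_union, Finset.mem_image, Finset.mem_univ, true_and,
          exists_exists_eq_and] at hx
        rcases hx with ⟨j, rfl⟩ | ⟨j, rfl⟩
        · have h := le_desR_of_parent_eq (dsSize n) T (hu j) (by simp) (hfp j)
          simp only [dsSize] at h ⊢
          omega
        · simp [dsSize]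
    · rcases hf v with h | h
      · exact Or.inl (Finset.mem_image.mpr ⟨v, Finset.mem_univ v, h⟩)
      · exact Or.inr ⟨f v, Finset.mem_image_of_mem f (Finset.mem_univ v), h.symm⟩

end DSReduction
end

section
/- For every n ≥ 3, consider the graph G with vertex set {r} ∪ {u_1,…,u_n} ∪ {s_3,…,s_n} and edges {r,u_1}, {u_i,u_{i+1}} for 1 ≤ i ≤ n−1, and {r,s_i}, {s_i,u_i} for 3 ≤ i ≤ n; take sources U = {u_1,…,u_n} with s(u_i) = 1 and s = 0 on all other vertices, q = 2, and Tx = Rx = 1. Then: (i) the unique subtree of G containing U ∪ {r} with the minimum possible number of edges is the path r,u_1,u_2,…,u_n, and its energy cost equals 2·Σ_{j=1}^{n} ⌈j/2⌉ ≥ n²/2; and (ii) the routing tree with edges {u_1,r}, {u_2,u_1}, and {u_i,s_i}, {s_i,r} for 3 ≤ i ≤ n has energy cost 4n−4. Consequently the approximation ratio of a Steiner tree (minimum-edge) algorithm for the minimum energy-cost aggregation tree problem with relay nodes is at least Θ(|U|). -/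
open Finset

variable {V : Type*} [Fintype V] [DecidableEq V]

section SteinerLB

/-- Indices of the relay vertices `s_3, …, s_n` of the instance: `s_i` (for `3 ≤ i ≤ n`)
corresponds to the index `i − 1 ∈ {2, …, n−1}` (0-based). -/
abbrev SIdx (n : ℕ) : Type := {i : Fin n // 2 ≤ (i : ℕ)}

/-- The vertex set `{r} ∪ {u_1,…,u_n} ∪ {s_3,…,s_n}` (0-based: `u_i ↦ i − 1`). -/
abbrev StVert (n : ℕ) : Type := Unit ⊕ Fin n ⊕ SIdx n

/-- The adjacency generator: edges `{r,u_1}`, `{u_i,u_{i+1}}`, `{r,s_i}`, `{s_i,u_i}`. -/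
def stRel (n : ℕ) : StVert n → StVert n → Prop
  | Sum.inl _, Sum.inr (Sum.inl i) => (i : ℕ) = 0
  | Sum.inr (Sum.inl a), Sum.inr (Sum.inl b) => (b : ℕ) = (a : ℕ) + 1
  | Sum.inl _, Sum.inr (Sum.inr _) => True
  | Sum.inr (Sum.inl a), Sum.inr (Sum.inr i) => i.1 = a
  | _, _ => False

/-- The instance graph. -/
def stGraph (n : ℕ) : SimpleGraph (StVert n) := SimpleGraph.fromRel (stRel n)

/-- The sources `U = {u_1, …, u_n}`. -/
def stSources (n : ℕ) : Finset (StVert n) :=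
  Finset.univ.image (fun i => Sum.inr (Sum.inl i))

/-- Report sizes: `s(u_i) = 1` and `s = 0` on all other vertices. -/
def stSize (n : ℕ) : StVert n → ℕ
  | Sum.inr (Sum.inl _) => 1
  | _ => 0

/-- The parent function of the path `r, u_1, u_2, …, u_n`. -/
def stPathParent (n : ℕ) : StVert n → StVert n
  | Sum.inr (Sum.inl i) =>
      if (i : ℕ) = 0 then Sum.inl ()
      else Sum.inr (Sum.inl ⟨(i : ℕ) - 1, Nat.lt_of_le_of_lt (Nat.sub_le _ _) i.isLt⟩)
  | v => v

/-- The parent function of the low-cost tree `T_O`, with edges `{u_1,r}`, `{u_2,u_1}`, and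
`{u_i,s_i}`, `{s_i,r}` for `3 ≤ i ≤ n`. -/
def stOptParent (n : ℕ) (hn : 3 ≤ n) : StVert n → StVert n
  | Sum.inr (Sum.inl i) =>
      if h0 : (i : ℕ) = 0 then Sum.inl ()
      else if h1 : (i : ℕ) = 1 then Sum.inr (Sum.inl ⟨0, by omega⟩)
      else Sum.inr (Sum.inr ⟨i, by omega⟩)
  | Sum.inr (Sum.inr _) => Sum.inl ()
  | v => v

theorem stGraph_adj_iff {n : ℕ} {v w : StVert n} :
    (stGraph n).Adj v w ↔ v ≠ w ∧ (stRel n v w ∨ stRel n w v) :=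
  SimpleGraph.fromRel_adj _ _ _

theorem card_SIdx (n : ℕ) : Fintype.card (SIdx n) = n - 2 := by
  rw [← Fintype.card_fin (n - 2)]
  refine Fintype.card_congr
    { toFun := fun i => ⟨i.1 - 2, by have := i.1.2; have := i.2; omega⟩
      invFun := fun i => ⟨⟨i + 2, by omega⟩, by simp⟩
      left_inv := ?_
      right_inv := ?_ }
  · intro i
    have := i.2
    ext
    simp only
    omega
  · intro i
    simp

theorem card_insert_stSources (n : ℕ) :
    (insert (Sum.inl ()) (stSources n) : Finset (StVert n)).card = n + 1 := by
  rw [card_insert_of_notMem (by simp [stSources]), stSources,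
    card_image_of_injective _ fun _ _ h => Sum.inl_injective (Sum.inr_injective h), card_univ,
    Fintype.card_fin]

theorem sum_stSources {M : Type*} [AddCommMonoid M] {n : ℕ} (f : StVert n → M) :
    ∑ v ∈ stSources n, f v = ∑ i, f (Sum.inr (Sum.inl i)) :=
  sum_image fun _ _ _ _ h => Sum.inl_injective (Sum.inr_injective h)

theorem insert_stSources_subset {n : ℕ} (T : RelayTree (stGraph n) (Sum.inl ()) (stSources n)) :
    insert (Sum.inl ()) (stSources n) ⊆ T.verts :=
  insert_subset T.root_mem T.source_subset

theorem iterate_mem_pair {α : Type*} {f : α → α} {a b : α} (hab : f a = b) (hba : f b = a)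
    (k : ℕ) : f^[k] a = a ∨ f^[k] a = b := by
  induction k with
  | zero => simp
  | succ k ih =>
    rw [Function.iterate_succ_apply']
    rcases ih with h | h <;> simp [h, hab, hba]

/-- In a routing tree on exactly the sources and the sink, every parent is the predecessor on
the path. -/
theorem parent_eq_stPathParent {n : ℕ} (T : RelayTree (stGraph n) (Sum.inl ()) (stSources n))
    (hT : T.verts = insert (Sum.inl ()) (stSources n)) (i : Fin n) :
    T.parent (Sum.inr (Sum.inl i)) = stPathParent n (Sum.inr (Sum.inl i)) := by
  have hmem (i : Fin n) : (Sum.inr (Sum.inl i) : StVert n) ∈ T.verts := by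
    simp [hT, stSources]
  have hstep (i : Fin n) :
      T.parent (Sum.inr (Sum.inl i)) = stPathParent n (Sum.inr (Sum.inl i)) ∨
      ∃ j : Fin n, (j : ℕ) = i + 1 ∧ T.parent (Sum.inr (Sum.inl i)) = Sum.inr (Sum.inl j) := by
    have hadj := T.adj _ (hmem i) (by simp)
    have hp := T.parent_mem _ (hmem i)
    rw [stGraph_adj_iff] at hadj
    generalize T.parent (Sum.inr (Sum.inl i)) = p at hadj hp ⊢
    rcases p with _ | j | j
    · left
      simpa [stRel, stPathParent] using hadj
    · have h : (j : ℕ) = i + 1 ∨ (i : ℕ) = j + 1 := by simpa [stRel] using hadj.2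
      rcases h with h | h
      · exact Or.inr ⟨j, h, rfl⟩
      · left
        simp [stPathParent, h]
    · simp [hT, stSources] at hp
  induction hd : n - i using Nat.strong_induction_on generalizing i with
  | _ d ih =>
    rcases hstep i with h | ⟨j, hj, hij⟩
    · exact h
    · exfalso
      have hji := ih (n - j) (by omega) j rfl
      have hji' : T.parent (Sum.inr (Sum.inl j)) = Sum.inr (Sum.inl i) := by
        rw [hji]
        simp [stPathParent, hj]
      obtain ⟨k, hk⟩ := T.reaches _ (hmem i)
      rcases iterate_mem_pair hij hji' k with h | h <;> rw [hk] at h <;> simp at h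

theorem exists_iterate_stPathParent_iff {n : ℕ} {f : StVert n → StVert n}
    (hr : f (Sum.inl ()) = Sum.inl ())
    (hf : ∀ i, f (Sum.inr (Sum.inl i)) = stPathParent n (Sum.inr (Sum.inl i))) (i j : Fin n) :
    (∃ k, f^[k] (Sum.inr (Sum.inl j)) = Sum.inr (Sum.inl i)) ↔ i ≤ j := by
  constructor
  · rintro ⟨k, hk⟩
    induction k generalizing j with
    | zero => simp at hk; simp [hk]
    | succ k ih =>
      rw [Function.iterate_succ_apply, hf] at hk
      simp only [stPathParent] at hk
      split_ifs at hk with h0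
      · rw [Function.iterate_fixed hr] at hk
        simp at hk
      · have := ih _ hk
        rw [Fin.le_def] at this ⊢
        simp only at this
        omega
  · intro hij
    induction hd : (j : ℕ) - i generalizing j with
    | zero =>
      have : j = i := by ext; rw [Fin.le_def] at hij; omega
      exact ⟨0, by simp [this]⟩
    | succ d ih =>
      obtain ⟨k, hk⟩ := ih ⟨j - 1, by omega⟩ (by rw [Fin.le_def]; simp only; omega)
        (by simp only; omega)
      refine ⟨k + 1, ?_⟩
      rw [Function.iterate_succ_apply, hf]
      simpa [stPathParent, show (j : ℕ) ≠ 0 by omega] using hk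

theorem exists_iterate_stPathParent_eq_root {n : ℕ} (i : Fin n) :
    ∃ k, (stPathParent n)^[k] (Sum.inr (Sum.inl i)) = Sum.inl () := by
  induction hd : (i : ℕ) generalizing i with
  | zero => exact ⟨1, by simp [stPathParent, hd]⟩
  | succ d ih =>
    obtain ⟨k, hk⟩ := ih ⟨d, by omega⟩ rfl
    exact ⟨k + 1, by simpa [Function.iterate_succ_apply, stPathParent, hd] using hk⟩

theorem stGraph_adj_stPathParent {n : ℕ} (i : Fin n) :
    (stGraph n).Adj (Sum.inr (Sum.inl i)) (stPathParent n (Sum.inr (Sum.inl i))) := by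
  rw [stGraph_adj_iff]
  simp only [stPathParent]
  split_ifs with h
  · simp [stRel, h]
  · simp only [ne_eq, Sum.inr.injEq, Sum.inl.injEq, Fin.ext_iff, stRel]
    omega

/-- The path `r, u_1, …, u_n` as a routing tree. -/
def stPathTree (n : ℕ) : RelayTree (stGraph n) (Sum.inl ()) (stSources n) where
  verts := insert (Sum.inl ()) (stSources n)
  root_mem := mem_insert_self _ _
  source_subset := subset_insert _ _
  parent := stPathParent n
  parent_mem := by
    rintro (_ | i | i) hv
    · exact hv
    · simp only [stPathParent]
      split_ifs <;> simp [stSources]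
    · exact hv
  parent_root := rfl
  adj := by
    rintro (_ | i | i) hv h
    · exact absurd rfl h
    · exact stGraph_adj_stPathParent i
    · simp [stSources] at hv
  reaches := by
    rintro (_ | i | i) hv
    · exact ⟨0, rfl⟩
    · exact exists_iterate_stPathParent_eq_root i
    · simp [stSources] at hv

theorem desR_of_verts_eq {n : ℕ} (T : RelayTree (stGraph n) (Sum.inl ()) (stSources n))
    (hT : T.verts = insert (Sum.inl ()) (stSources n)) (i : Fin n) :
    desR (stSize n) T (Sum.inr (Sum.inl i)) = n - 1 - i := by
  have hiff := exists_iterate_stPathParent_iff T.parent_root (parent_eq_stPathParent T hT)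
  have hcard : #{j : Fin n | j ≠ i ∧ i ≤ j} = n - 1 - i := by
    rw [← Fin.card_Ioi]
    congr 1
    ext j
    simp [lt_iff_le_and_ne, and_comm, eq_comm]
  rw [desR, hT, sum_insert (by simp [stSources]), sum_stSources]
  simpa [hiff, stSize, sum_boole] using hcard

theorem costR_of_verts_eq {n : ℕ} (T : RelayTree (stGraph n) (Sum.inl ()) (stSources n))
    (hT : T.verts = insert (Sum.inl ()) (stSources n)) :
    costR (stSize n) 2 1 1 T = 2 * ∑ j ∈ Finset.range n, (⌈((j : ℝ) + 1) / 2⌉ : ℝ) := by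
  rw [costR, one_add_one_eq_two, hT, erase_insert (by simp [stSources]), sum_stSources]
  congr 1
  rw [← sum_range_reflect, ← Fin.sum_univ_eq_sum_range
    (fun j => (⌈(((n - 1 - j : ℕ) : ℝ) + 1) / 2⌉ : ℝ))]
  refine sum_congr rfl fun i _ => ?_
  rw [desR_of_verts_eq T hT]
  simp [stSize]

theorem sq_div_two_le_two_mul_sum_ceil (n : ℕ) :
    (n : ℝ) ^ 2 / 2 ≤ 2 * ∑ j ∈ Finset.range n, (⌈((j : ℝ) + 1) / 2⌉ : ℝ) := by
  induction n with
  | zero => simp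
  | succ n ih =>
    rw [sum_range_succ]
    have := Int.le_ceil (((n : ℝ) + 1) / 2)
    push_cast
    nlinarith

theorem stOptParent_stOptParent {n : ℕ} (hn : 3 ≤ n) (v : StVert n) :
    stOptParent n hn (stOptParent n hn v) = Sum.inl () := by
  rcases v with _ | i | i
  · rfl
  · simp only [stOptParent]
    split_ifs <;> simp
  · rfl

/-- The low-cost tree as a routing tree. -/
def stOptTree (n : ℕ) (hn : 3 ≤ n) : RelayTree (stGraph n) (Sum.inl ()) (stSources n) where
  verts := univ
  root_mem := mem_univ _
  source_subset := subset_univ _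
  parent := stOptParent n hn
  parent_mem := fun _ _ => mem_univ _
  parent_root := rfl
  adj := by
    rintro (_ | i | i) - h
    · exact absurd rfl h
    · rw [stGraph_adj_iff]
      simp only [stOptParent]
      split_ifs with h0 h1 <;> simp [stRel, Fin.ext_iff, *]
    · simp [stGraph_adj_iff, stOptParent, stRel]
  reaches := fun v _ => ⟨2, stOptParent_stOptParent hn v⟩

theorem exists_iterate_stOptParent_iff {n : ℕ} (hn : 3 ≤ n) (u v : StVert n)
    (hv : v ≠ Sum.inl ()) :
    (∃ k, (stOptParent n hn)^[k] u = v) ↔ u = v ∨ stOptParent n hn u = v := by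
  constructor
  · rintro ⟨_ | _ | k, hk⟩
    · exact Or.inl hk
    · exact Or.inr hk
    · rw [Function.iterate_succ_apply, Function.iterate_succ_apply, stOptParent_stOptParent,
        Function.iterate_fixed rfl] at hk
      exact absurd hk.symm hv
  · rintro (h | h)
    · exact ⟨0, h⟩
    · exact ⟨1, h⟩

theorem stOptParent_ne_self {n : ℕ} (hn : 3 ≤ n) {v : StVert n} (hv : v ≠ Sum.inl ()) :
    stOptParent n hn v ≠ v :=
  fun h => ((stOptTree n hn).adj v (mem_univ _) hv).ne h.symm

theorem desR_stOptTree {n : ℕ} (hn : 3 ≤ n) (v : StVert n) (hv : v ≠ Sum.inl ()) :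
    desR (stSize n) (stOptTree n hn) v =
      #{i : Fin n | stOptParent n hn (Sum.inr (Sum.inl i)) = v} := by
  have hiff (u : StVert n) : (u ≠ v ∧ ∃ k, (stOptTree n hn).parent^[k] u = v) ↔
      stOptParent n hn u = v := by
    rw [show (stOptTree n hn).parent = stOptParent n hn from rfl,
      exists_iterate_stOptParent_iff hn u v hv]
    refine ⟨by tauto, fun h => ⟨?_, Or.inr h⟩⟩
    rintro rfl
    exact stOptParent_ne_self hn hv h
  rw [desR, show (stOptTree n hn).verts = univ from rfl]
  simp [hiff, stSize, sum_boole]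

theorem desR_stOptTree_le_one {n : ℕ} (hn : 3 ≤ n) (v : StVert n) (hv : v ≠ Sum.inl ()) :
    desR (stSize n) (stOptTree n hn) v ≤ 1 := by
  rw [desR_stOptTree hn v hv, card_le_one]
  intro i hi j hj
  rw [mem_filter_univ] at hi hj
  subst hi
  simp only [stOptParent] at hj hv
  ext
  split_ifs at hj hv <;> simp_all

theorem one_le_desR_stOptTree_relay {n : ℕ} (hn : 3 ≤ n) (i : SIdx n) :
    1 ≤ desR (stSize n) (stOptTree n hn) (Sum.inr (Sum.inr i)) := by
  rw [desR_stOptTree hn _ (by simp), Nat.one_le_iff_ne_zero, card_ne_zero]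
  refine ⟨i.1, (mem_filter_univ _).2 ?_⟩
  have := i.2
  simp [stOptParent, show (i.1 : ℕ) ≠ 0 by omega, show (i.1 : ℕ) ≠ 1 by omega]

theorem costR_stOptTree {n : ℕ} (hn : 3 ≤ n) :
    costR (stSize n) 2 1 1 (stOptTree n hn) = 4 * (n : ℝ) - 4 := by
  have hone : ∀ v ∈ (stOptTree n hn).verts.erase (Sum.inl ()),
      (⌈((desR (stSize n) (stOptTree n hn) v + stSize n v : ℕ) : ℝ) / ((2 : ℕ) : ℝ)⌉ : ℝ)
        = 1 := by
    intro v hv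
    have hv := ne_of_mem_erase hv
    have hle := desR_stOptTree_le_one hn v hv
    have h : 1 ≤ desR (stSize n) (stOptTree n hn) v + stSize n v ∧
        desR (stSize n) (stOptTree n hn) v + stSize n v ≤ 2 := by
      rcases v with _ | i | i
      · exact absurd rfl hv
      · simp only [stSize]
        omega
      · have := one_le_desR_stOptTree_relay hn i
        simp only [stSize]
        omega
    generalize desR (stSize n) (stOptTree n hn) v + stSize n v = m at h
    rw [← Int.cast_one, Int.cast_inj, Int.ceil_eq_iff]
    have h1 : (1 : ℝ) ≤ m := mod_cast h.1
    have h2 : (m : ℝ) ≤ 2 := mod_cast h.2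
    constructor <;> push_cast <;> linarith
  rw [costR, sum_congr rfl hone, sum_const, card_erase_of_mem (stOptTree n hn).root_mem,
    show (stOptTree n hn).verts = univ from rfl, card_univ]
  simp only [Fintype.card_sum, Fintype.card_unit, Fintype.card_fin, card_SIdx]
  rw [show 1 + (n + (n - 2)) - 1 = 2 * (n - 1) by omega, nsmul_eq_mul, Nat.cast_mul,
    Nat.cast_sub (by omega)]
  push_cast
  ring

/-- A Steiner tree (minimum-edge) algorithm has approximation ratio at least `Θ(|U|)` on
the family of instances `stGraph n` with `q = 2`, `Tx = Rx = 1`: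
(i) every routing tree with relay nodes has at least `n` edges (`n+1` vertices); the unique
one with the minimum number of edges is the path `r, u_1, …, u_n`, and its energy cost is
`2·Σ_{j=1}^{n} ⌈j/2⌉ ≥ n²/2`;
(ii) the routing tree with edges `{u_1,r}`, `{u_2,u_1}`, `{u_i,s_i}`, `{s_i,r}` has energy
cost `4n − 4`; hence any minimum-edge tree costs at least `n/8` times this tree. -/
theorem steiner_tree_bad_approximation (n : ℕ) (hn : 3 ≤ n) :
    (∀ T : RelayTree (stGraph n) (Sum.inl ()) (stSources n), n + 1 ≤ T.verts.card) ∧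
    (∀ T : RelayTree (stGraph n) (Sum.inl ()) (stSources n), T.verts.card = n + 1 →
      T.verts = insert (Sum.inl ()) (stSources n) ∧
      (∀ v ∈ T.verts, v ≠ Sum.inl () → T.parent v = stPathParent n v) ∧
      costR (stSize n) 2 1 1 T =
        2 * ∑ j ∈ Finset.range n, (⌈((j : ℝ) + 1) / 2⌉ : ℝ)) ∧
    ((n : ℝ) ^ 2 / 2 ≤ 2 * ∑ j ∈ Finset.range n, (⌈((j : ℝ) + 1) / 2⌉ : ℝ)) ∧
    (∃ TO : RelayTree (stGraph n) (Sum.inl ()) (stSources n),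
      TO.verts = Finset.univ ∧ TO.parent = stOptParent n hn ∧
      costR (stSize n) 2 1 1 TO = 4 * (n : ℝ) - 4 ∧
      ∀ T : RelayTree (stGraph n) (Sum.inl ()) (stSources n),
        (∀ T' : RelayTree (stGraph n) (Sum.inl ()) (stSources n),
          T.verts.card ≤ T'.verts.card) →
        ((n : ℝ) / 8) * costR (stSize n) 2 1 1 TO ≤ costR (stSize n) 2 1 1 T) := by
  have hlow (T : RelayTree (stGraph n) (Sum.inl ()) (stSources n)) : n + 1 ≤ T.verts.card :=
    card_insert_stSources n ▸ card_le_card (insert_stSources_subset T)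
  have hverts (T : RelayTree (stGraph n) (Sum.inl ()) (stSources n))
      (hT : T.verts.card = n + 1) : T.verts = insert (Sum.inl ()) (stSources n) :=
    (eq_of_subset_of_card_le (insert_stSources_subset T)
      (by rw [hT, card_insert_stSources])).symm
  refine ⟨hlow, fun T hT => ⟨hverts T hT, ?_, costR_of_verts_eq T (hverts T hT)⟩,
    sq_div_two_le_two_mul_sum_ceil n, stOptTree n hn, rfl, rfl, costR_stOptTree hn, ?_⟩
  · rintro (_ | i | i) hv h
    · exact absurd rfl h
    · exact parent_eq_stPathParent T (hverts T hT) i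
    · simp [hverts T hT, stSources] at hv
  · intro T hmin
    have hcard : T.verts.card = n + 1 :=
      le_antisymm ((hmin (stPathTree n)).trans (card_insert_stSources n).le) (hlow T)
    rw [costR_of_verts_eq T (hverts T hcard), costR_stOptTree hn]
    have := sq_div_two_le_two_mul_sum_ceil n
    have : (0 : ℝ) ≤ n := Nat.cast_nonneg n
    nlinarith

end SteinerLB
end

section
/- For every n ≥ 3, consider the graph G with vertex set {r} ∪ {u_1,…,u_n} ∪ {s_{i,j} : 3 ≤ i ≤ n, 1 ≤ j ≤ i−2} and edges {r,u_1}, {u_i,u_{i+1}} for 1 ≤ i ≤ n−1, {r,s_{i,1}} and {s_{i,i−2},u_i} for 3 ≤ i ≤ n, and {s_{i,j},s_{i,j+1}} for 3 ≤ i ≤ n, 1 ≤ j ≤ i−3; take sources U = {u_1,…,u_n} with s(u_i) = 1 and s = 0 on all other vertices, q = n, and Tx = Rx = 1. Then: (i) the spanning tree T_S with edges (u_1,r), (u_2,u_1), and, for each 3 ≤ i ≤ n, (s_{i,1},r), (s_{i,j+1},s_{i,j}) for 1 ≤ j ≤ i−3, and (u_i,s_{i,i−2}), is a shortest path tree of G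 rooted at r (every vertex's hop distance to r in T_S equals its hop distance in G), and its energy cost equals n(n−1)+2; and (ii) the routing tree consisting of the path r,u_1,…,u_n has energy cost 2n. Consequently the approximation ratio of a shortest path tree algorithm for the minimum energy-cost aggregation tree problem with relay nodes is at least Θ(|U|). -/
open Finset

variable {V : Type*} [Fintype V] [DecidableEq V]

section SPTLB

/-- Indices of the relay vertices `s_{i,j}` (`3 ≤ i ≤ n`, `1 ≤ j ≤ i−2`) of the instance:
`s_{i,j}` corresponds to the 0-based pair `(a,b) = (i−1, j−1)` with `2 ≤ a` and `b+1 < a`. -/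
abbrev SPIdx (n : ℕ) : Type := {p : Fin n × Fin n // 2 ≤ (p.1 : ℕ) ∧ (p.2 : ℕ) + 1 < (p.1 : ℕ)}

/-- The vertex set `{r} ∪ {u_1,…,u_n} ∪ {s_{i,j}}` (0-based: `u_i ↦ i − 1`). -/
abbrev SPVert (n : ℕ) : Type := Unit ⊕ Fin n ⊕ SPIdx n

/-- The adjacency generator: edges `{r,u_1}`, `{u_i,u_{i+1}}`, `{r,s_{i,1}}`,
`{s_{i,j},s_{i,j+1}}`, and `{s_{i,i−2},u_i}`. -/
def spRel (n : ℕ) : SPVert n → SPVert n → Prop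
  | Sum.inl _, Sum.inr (Sum.inl i) => (i : ℕ) = 0
  | Sum.inr (Sum.inl a), Sum.inr (Sum.inl b) => (b : ℕ) = (a : ℕ) + 1
  | Sum.inl _, Sum.inr (Sum.inr p) => (p.1.2 : ℕ) = 0
  | Sum.inr (Sum.inr p), Sum.inr (Sum.inr p') =>
      p.1.1 = p'.1.1 ∧ (p'.1.2 : ℕ) = (p.1.2 : ℕ) + 1
  | Sum.inr (Sum.inl a), Sum.inr (Sum.inr p) =>
      p.1.1 = a ∧ (p.1.2 : ℕ) + 2 = (a : ℕ)
  | _, _ => False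

/-- The instance graph. -/
def spGraph (n : ℕ) : SimpleGraph (SPVert n) := SimpleGraph.fromRel (spRel n)

/-- The sources `U = {u_1, …, u_n}`. -/
def spSources (n : ℕ) : Finset (SPVert n) :=
  Finset.univ.image (fun i => Sum.inr (Sum.inl i))

/-- Report sizes: `s(u_i) = 1` and `s = 0` on all other vertices. -/
def spSize (n : ℕ) : SPVert n → ℕ
  | Sum.inr (Sum.inl _) => 1
  | _ => 0

/-- The parent function of the tree `T_S` with edges `(u_1,r)`, `(u_2,u_1)`, and, for each
`3 ≤ i ≤ n`, `(s_{i,1},r)`, `(s_{i,j+1},s_{i,j})`, and `(u_i,s_{i,i−2})`. -/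
def spSptParent (n : ℕ) : SPVert n → SPVert n
  | Sum.inr (Sum.inl a) =>
      if h0 : (a : ℕ) = 0 then Sum.inl ()
      else if h1 : (a : ℕ) = 1 then
        Sum.inr (Sum.inl ⟨0, Nat.lt_of_le_of_lt (Nat.zero_le _) a.isLt⟩)
      else
        Sum.inr (Sum.inr ⟨(a, ⟨(a : ℕ) - 2,
          Nat.lt_of_le_of_lt (Nat.sub_le _ _) a.isLt⟩), by
            have := a.isLt; simp only []; omega⟩)
  | Sum.inr (Sum.inr p) =>
      if h0 : (p.1.2 : ℕ) = 0 then Sum.inl ()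
      else
        Sum.inr (Sum.inr ⟨(p.1.1, ⟨(p.1.2 : ℕ) - 1,
          Nat.lt_of_le_of_lt (Nat.sub_le _ _) p.1.2.isLt⟩), by
            have h2 := p.2.1; have h3 := p.2.2; constructor <;> simp only [] <;> omega⟩)
  | v => v

/-- The parent function of the path `r, u_1, u_2, …, u_n`. -/
def spOptParent (n : ℕ) : SPVert n → SPVert n
  | Sum.inr (Sum.inl i) =>
      if (i : ℕ) = 0 then Sum.inl ()
      else Sum.inr (Sum.inl ⟨(i : ℕ) - 1, Nat.lt_of_le_of_lt (Nat.sub_le _ _) i.isLt⟩)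
  | v => v

/-- If `d` vanishes exactly at `r` and drops by one along `p`, then `p` reaches `r`
from `v` after `d v` steps. -/
theorem iterate_depth_eq_root {W : Type*} {r : W} {p : W → W} {d : W → ℕ} {S : Set W}
    (hmem : ∀ v ∈ S, p v ∈ S) (hzero : d r = 0)
    (hstep : ∀ v ∈ S, v ≠ r → d (p v) + 1 = d v) {v : W} (hv : v ∈ S) :
    p^[d v] v = r := by
  induction hk : d v generalizing v with
  | zero =>
    by_contra hne
    have := hstep v hv hne
    omega
  | succ k ih =>
    have hne : v ≠ r := by rintro rfl; omega
    have := hstep v hv hne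
    exact ih (hmem v hv) (by omega)

theorem le_depth_add_iterate {W : Type*} {r : W} {p : W → W} {d : W → ℕ}
    (hroot : p r = r) (hstep : ∀ v, v ≠ r → d (p v) + 1 = d v) (v : W) (k : ℕ) :
    d v ≤ d (p^[k] v) + k := by
  induction k generalizing v with
  | zero => simp
  | succ k ih =>
    have := ih (p v)
    rw [Function.iterate_succ_apply]
    by_cases hv : v = r
    · subst hv
      rw [hroot] at this ⊢
      omega
    · have := hstep v hv
      omega

theorem relayDist_eq_depth {W : Type*} {G : SimpleGraph W} {r : W} {U : Finset W}
    (T : RelayTree G r U) {d : W → ℕ} (hzero : d r = 0)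
    (hstep : ∀ v, v ≠ r → d (T.parent v) + 1 = d v) (v : W) : relayDist T v = d v := by
  have hmem : d v ∈ {n : ℕ | T.parent^[n] v = r} :=
    iterate_depth_eq_root (S := Set.univ) (by simp) hzero (fun v _ => hstep v) (by simp)
  refine le_antisymm (Nat.sInf_le hmem) (le_csInf ⟨_, hmem⟩ ?_)
  intro k hk
  have := le_depth_add_iterate T.parent_root hstep v k
  rw [Set.mem_ofPred_eq] at hk
  rw [hk, hzero] at this
  omega

theorem SimpleGraph.Walk.depth_le_add_length {W : Type*} {G : SimpleGraph W} {d : W → ℕ}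
    (hadj : ∀ v w, G.Adj v w → d v ≤ d w + 1) {v w : W} (p : G.Walk v w) :
    d v ≤ d w + p.length := by
  induction p with
  | nil => simp
  | cons h p ih =>
    have := hadj _ _ h
    rw [SimpleGraph.Walk.length_cons]
    omega

theorem SimpleGraph.exists_walk_length_eq_depth {W : Type*} {G : SimpleGraph W} {r : W}
    {p : W → W} {d : W → ℕ} (hzero : d r = 0) (hstep : ∀ v, v ≠ r → d (p v) + 1 = d v)
    (hpar : ∀ v, v ≠ r → G.Adj v (p v)) (v : W) : ∃ q : G.Walk v r, q.length = d v := by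
  induction hk : d v generalizing v with
  | zero =>
    have hv : v = r := by
      by_contra hne
      have := hstep v hne
      omega
    subst hv
    exact ⟨.nil, rfl⟩
  | succ k ih =>
    have hne : v ≠ r := by rintro rfl; omega
    have := hstep v hne
    obtain ⟨q, hq⟩ := ih (p v) (by omega)
    exact ⟨.cons (hpar v hne) q, by simp [hq]⟩

theorem SimpleGraph.dist_eq_depth {W : Type*} {G : SimpleGraph W} {r : W} {p : W → W}
    {d : W → ℕ} (hzero : d r = 0) (hstep : ∀ v, v ≠ r → d (p v) + 1 = d v)
    (hpar : ∀ v, v ≠ r → G.Adj v (p v)) (hadj : ∀ v w, G.Adj v w → d v ≤ d w + 1) (v : W) :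
    G.dist v r = d v := by
  obtain ⟨q, hq⟩ := SimpleGraph.exists_walk_length_eq_depth hzero hstep hpar v
  obtain ⟨q', hq'⟩ := q.reachable.exists_walk_length_eq_dist
  have h1 := SimpleGraph.dist_le q
  have h2 := q'.depth_le_add_length hadj
  omega

/-- The load `des_T(v) + s(v)` of a vertex never exceeds the total report size. -/
theorem desR_add_le_sum {W : Type*} [DecidableEq W] {G : SimpleGraph W} {r : W} {U : Finset W}
    (s : W → ℕ) (T : RelayTree G r U) {v : W} (hv : v ∈ T.verts) :
    desR s T v + s v ≤ ∑ u ∈ T.verts, s u := by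
  classical
  rw [desR, ← Finset.add_sum_erase _ s hv, ← Finset.add_sum_erase _ _ hv]
  simp only [ne_eq, not_true_eq_false, false_and, if_false, zero_add]
  rw [add_comm]
  gcongr
  split_ifs <;> simp

theorem one_le_desR_add {W : Type*} [DecidableEq W] {G : SimpleGraph W} {r : W} {U : Finset W}
    (s : W → ℕ) (T : RelayTree G r U) {u v : W} (hu : u ∈ T.verts) (hs : 1 ≤ s u)
    (huv : ∃ k, T.parent^[k] u = v) : 1 ≤ desR s T v + s v := by
  classical
  by_cases h : u = v
  · subst h
    omega
  · have := Finset.single_le_sum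
      (f := fun u => if u ≠ v ∧ (∃ n, T.parent^[n] u = v) then s u else 0)
      (fun _ _ => Nat.zero_le _) hu
    simp only [ne_eq, h, not_false_eq_true, huv, and_self, if_true] at this
    rw [desR]
    simp only [ne_eq]
    omega

/-- If all reports fit into one packet and every tree vertex forwards some report, then every
non-root vertex sends exactly one packet. -/
theorem costR_eq_of_sum_le {W : Type*} [DecidableEq W] {G : SimpleGraph W} {r : W} {U : Finset W}
    (s : W → ℕ) (q : ℕ) (Tx Rx : ℝ) (T : RelayTree G r U) (hq : ∑ u ∈ T.verts, s u ≤ q)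
    (hload : ∀ v ∈ T.verts, v ≠ r → ∃ u ∈ T.verts, 1 ≤ s u ∧ ∃ k, T.parent^[k] u = v) :
    costR s q Tx Rx T = (Tx + Rx) * ((T.verts.erase r).card : ℝ) := by
  rw [costR]
  congr 1
  rw [Finset.cast_card]
  refine Finset.sum_congr rfl fun v hv => ?_
  obtain ⟨hvr, hv⟩ := Finset.mem_erase.1 hv
  obtain ⟨u, hu, hs, huv⟩ := hload v hv hvr
  have h1 := one_le_desR_add s T hu hs huv
  have h2 := (desR_add_le_sum s T hv).trans hq
  have hq0 : (0 : ℝ) < q := by exact_mod_cast h1.trans h2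
  suffices ⌈(((desR s T v + s v : ℕ) : ℝ) / (q : ℝ))⌉ = 1 by rw [this]; norm_num
  rw [Int.ceil_eq_iff]
  constructor
  · have : (0 : ℝ) < ((desR s T v + s v : ℕ) : ℝ) := by exact_mod_cast h1
    simpa using div_pos this hq0
  · rw [div_le_iff₀ hq0]
    simpa using (Nat.cast_le (α := ℝ)).2 h2

/-- The hop distance to the root in `spGraph n`. -/
def spDepth (n : ℕ) : SPVert n → ℕ
  | Sum.inl _ => 0
  | Sum.inr (Sum.inl a) => if (a : ℕ) ≤ 1 then (a : ℕ) + 1 else (a : ℕ)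
  | Sum.inr (Sum.inr p) => (p.1.2 : ℕ) + 1

theorem spDepth_sptParent (n : ℕ) (v : SPVert n) (hv : v ≠ Sum.inl ()) :
    spDepth n (spSptParent n v) + 1 = spDepth n v := by
  rcases v with ⟨⟩ | a | p
  · exact absurd rfl hv
  · simp only [spSptParent]
    split_ifs with h0 h1
    · simp [spDepth, h0]
    · simp [spDepth, h1]
    · simp only [spDepth]
      split_ifs <;> omega
  · simp only [spSptParent]
    split_ifs with h0
    · simp [spDepth, h0]
    · simp only [spDepth]
      omega

theorem spGraph_adj_sptParent (n : ℕ) (v : SPVert n) (hv : v ≠ Sum.inl ()) :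
    (spGraph n).Adj v (spSptParent n v) := by
  have hne : v ≠ spSptParent n v := by
    intro h
    have := spDepth_sptParent n v hv
    rw [← h] at this
    omega
  rw [spGraph, SimpleGraph.fromRel_adj]
  refine ⟨hne, ?_⟩
  clear hne
  rcases v with ⟨⟩ | a | p
  · exact absurd rfl hv
  · simp only [spSptParent]
    split_ifs with h0 h1
    · simp [spRel, h0]
    · simp [spRel, h1]
    · simp only [spRel, true_and]
      omega
  · simp only [spSptParent]
    split_ifs with h0
    · simp [spRel, h0]
    · simp only [spRel, true_and]
      omega

theorem spDepth_le_of_spRel (n : ℕ) (v w : SPVert n) (h : spRel n v w) :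
    spDepth n v ≤ spDepth n w + 1 ∧ spDepth n w ≤ spDepth n v + 1 := by
  rcases v with ⟨⟩ | a | p <;> rcases w with ⟨⟩ | b | p' <;> simp only [spRel] at h <;>
    simp only [spDepth] <;> (try split_ifs) <;> omega

theorem spDepth_le_of_adj (n : ℕ) (v w : SPVert n) (h : (spGraph n).Adj v w) :
    spDepth n v ≤ spDepth n w + 1 := by
  rw [spGraph, SimpleGraph.fromRel_adj] at h
  exact h.2.elim (fun h => (spDepth_le_of_spRel n v w h).1)
    (fun h => (spDepth_le_of_spRel n w v h).2)

theorem sptParent_iterate_source (n : ℕ) (a : Fin n) (k : ℕ) (b : Fin n)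
    (hp : 2 ≤ (a : ℕ) ∧ (b : ℕ) + 1 < (a : ℕ)) (hk : (b : ℕ) + k + 2 = a) :
    (spSptParent n)^[k + 1] (Sum.inr (Sum.inl a)) = Sum.inr (Sum.inr ⟨(a, b), hp⟩) := by
  induction k generalizing b with
  | zero =>
    have h0 : (a : ℕ) ≠ 0 := by omega
    have h1 : (a : ℕ) ≠ 1 := by omega
    have hb : (a : ℕ) - 2 = b := by omega
    simp [spSptParent, h0, h1, hb]
  | succ k ih =>
    have hb : (b : ℕ) + 1 < n := by omega
    rw [Function.iterate_succ_apply', ih ⟨b + 1, hb⟩ (by simp only; omega) (by simp only; omega)]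
    simp [spSptParent]

theorem sum_spSize (n : ℕ) : ∑ v, spSize n v = n := by
  simp [Fintype.sum_sum_type, spSize]

theorem sum_spSize_le (n : ℕ) (S : Finset (SPVert n)) : ∑ v ∈ S, spSize n v ≤ n :=
  (Finset.sum_le_sum_of_subset (Finset.subset_univ S)).trans (sum_spSize n).le

/-- Relay vertices correspond to pairs of a source index `a` and one of `a - 1` positions. -/
def spIdxEquiv (n : ℕ) : SPIdx n ≃ (a : Fin n) × Fin ((a : ℕ) - 1) where
  toFun p := ⟨p.1.1, ⟨p.1.2, by have := p.2; omega⟩⟩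
  invFun x := ⟨(x.1, ⟨x.2, by have := x.1.isLt; have := x.2.isLt; omega⟩), by
    have := x.2.isLt; dsimp only; omega⟩
  left_inv _ := rfl
  right_inv _ := rfl

theorem sum_range_pred_mul_two (m : ℕ) : (∑ a ∈ Finset.range (m + 1), (a - 1)) * 2 + m = m * m := by
  induction m with
  | zero => simp
  | succ m ih =>
    rw [Finset.sum_range_succ, add_mul, Nat.add_sub_cancel]
    linarith

theorem two_mul_card_spVert (n : ℕ) (hn : 1 ≤ n) :
    2 * (((Finset.univ : Finset (SPVert n)).erase (Sum.inl ())).card : ℝ) =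
      (n : ℝ) * ((n : ℝ) - 1) + 2 := by
  obtain ⟨m, rfl⟩ : ∃ m, n = m + 1 := ⟨n - 1, by omega⟩
  have hidx : Fintype.card (SPIdx (m + 1)) = ∑ a ∈ Finset.range (m + 1), (a - 1) := by
    rw [Fintype.card_congr (spIdxEquiv (m + 1)), Fintype.card_sigma]
    simp only [Fintype.card_fin]
    exact Fin.sum_univ_eq_sum_range (fun a => a - 1) (m + 1)
  have hsum : (((∑ a ∈ Finset.range (m + 1), (a - 1) : ℕ) : ℝ)) * 2 + m = m * m := by
    exact_mod_cast sum_range_pred_mul_two m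
  rw [Finset.card_erase_of_mem (Finset.mem_univ _), Finset.card_univ, Fintype.card_sum,
    Fintype.card_sum, hidx, Fintype.card_unit, Fintype.card_fin, Nat.add_sub_cancel_left]
  push_cast at hsum ⊢
  linarith

/-- The shortest path tree `T_S`. -/
def spSptTree (n : ℕ) : RelayTree (spGraph n) (Sum.inl ()) (spSources n) where
  verts := Finset.univ
  root_mem := Finset.mem_univ _
  source_subset := Finset.subset_univ _
  parent := spSptParent n
  parent_mem _ _ := Finset.mem_univ _
  parent_root := rfl
  adj v _ hv := spGraph_adj_sptParent n v hv
  reaches v _ := ⟨spDepth n v, iterate_depth_eq_root (d := spDepth n) (S := Set.univ) (by simp) rfl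
    (fun v _ => spDepth_sptParent n v) (Set.mem_univ v)⟩

theorem costR_spSptTree (n : ℕ) (hn : 1 ≤ n) :
    costR (spSize n) n 1 1 (spSptTree n) = (n : ℝ) * ((n : ℝ) - 1) + 2 := by
  rw [costR_eq_of_sum_le _ _ _ _ _ (sum_spSize_le n _), ← two_mul_card_spVert n hn]
  · norm_num [spSptTree]
  · rintro (⟨⟩ | a | ⟨⟨a, b⟩, hp⟩) _ hv
    · exact absurd rfl hv
    · exact ⟨_, Finset.mem_univ _, le_rfl, 0, rfl⟩
    · refine ⟨Sum.inr (Sum.inl a), Finset.mem_univ _, le_rfl, (a - 2 - b : ℕ) + 1,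
        sptParent_iterate_source n a _ b hp ?_⟩
      dsimp only at hp
      omega

theorem mem_insert_spSources (n : ℕ) (v : SPVert n) :
    v ∈ insert (Sum.inl ()) (spSources n) ↔ v = Sum.inl () ∨ ∃ i, Sum.inr (Sum.inl i) = v := by
  simp [spSources]

theorem spOptParent_mem (n : ℕ) (v : SPVert n) (hv : v ∈ insert (Sum.inl ()) (spSources n)) :
    spOptParent n v ∈ insert (Sum.inl ()) (spSources n) := by
  rw [mem_insert_spSources] at hv ⊢
  obtain rfl | ⟨i, rfl⟩ := hv
  · exact Or.inl rfl
  · simp only [spOptParent]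
    split_ifs
    · exact Or.inl rfl
    · exact Or.inr ⟨_, rfl⟩

/-- The position of a vertex on the path `r, u_1, …, u_n`. -/
def spPathDepth (n : ℕ) : SPVert n → ℕ
  | Sum.inr (Sum.inl a) => (a : ℕ) + 1
  | _ => 0

/-- The routing tree consisting of the path `r, u_1, …, u_n`. -/
def spOptTree (n : ℕ) : RelayTree (spGraph n) (Sum.inl ()) (spSources n) where
  verts := insert (Sum.inl ()) (spSources n)
  root_mem := Finset.mem_insert_self _ _
  source_subset := Finset.subset_insert _ _
  parent := spOptParent n
  parent_mem := spOptParent_mem n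
  parent_root := rfl
  adj v hv hr := by
    rw [mem_insert_spSources] at hv
    obtain rfl | ⟨i, rfl⟩ := hv
    · exact absurd rfl hr
    · rw [spGraph, SimpleGraph.fromRel_adj]
      simp only [spOptParent]
      split_ifs with h0
      · simp [spRel, h0]
      · simp only [spRel, ne_eq, Sum.inr.injEq, Sum.inl.injEq, Fin.ext_iff]
        omega
  reaches v hv := ⟨spPathDepth n v, by
    refine iterate_depth_eq_root (d := spPathDepth n)
      (S := {v | v ∈ insert (Sum.inl ()) (spSources n)}) (spOptParent_mem n) rfl ?_ hv
    intro v hv hr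
    rw [Set.mem_ofPred_eq, mem_insert_spSources] at hv
    obtain rfl | ⟨i, rfl⟩ := hv
    · exact absurd rfl hr
    · simp only [spOptParent]
      split_ifs with h0
      · simp [spPathDepth, h0]
      · simp only [spPathDepth]
        omega⟩

theorem costR_spOptTree (n : ℕ) : costR (spSize n) n 1 1 (spOptTree n) = 2 * (n : ℝ) := by
  rw [costR_eq_of_sum_le _ _ _ _ _ (sum_spSize_le n _)]
  · have hroot : Sum.inl () ∉ spSources n := by simp [spSources]
    have hcard : (spSources n).card = n := by
      rw [spSources,
        Finset.card_image_of_injective _ fun _ _ h => Sum.inl_injective (Sum.inr_injective h),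
        Finset.card_univ, Fintype.card_fin]
    rw [show (spOptTree n).verts = insert (Sum.inl ()) (spSources n) from rfl,
      Finset.erase_insert hroot, hcard]
    norm_num
  · intro v hv hr
    obtain rfl | ⟨i, rfl⟩ := (mem_insert_spSources n v).1 hv
    · exact absurd rfl hr
    · exact ⟨_, hv, le_rfl, 0, rfl⟩

/-- A shortest path tree algorithm has approximation ratio at least `Θ(|U|)` on the family
of instances `spGraph n` with `q = n`, `Tx = Rx = 1`:
(i) the spanning tree `T_S` with parent function `spSptParent` is a shortest path tree of
`G` rooted at `r` and has energy cost `n(n−1)+2`;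
(ii) the routing tree consisting of the path `r, u_1, …, u_n` has energy cost `2n`;
hence `T_S` costs at least `(n−1)/2` times the tree of (ii). -/
theorem spt_bad_approximation (n : ℕ) (hn : 3 ≤ n) :
    ∃ TS : RelayTree (spGraph n) (Sum.inl ()) (spSources n),
      TS.verts = Finset.univ ∧ TS.parent = spSptParent n ∧
      (∀ v : SPVert n, relayDist TS v = (spGraph n).dist v (Sum.inl ())) ∧
      costR (spSize n) n 1 1 TS = (n : ℝ) * ((n : ℝ) - 1) + 2 ∧
      ∃ TO : RelayTree (spGraph n) (Sum.inl ()) (spSources n),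
        TO.verts = insert (Sum.inl ()) (spSources n) ∧ TO.parent = spOptParent n ∧
        costR (spSize n) n 1 1 TO = 2 * (n : ℝ) ∧
        (((n : ℝ) - 1) / 2) * costR (spSize n) n 1 1 TO ≤ costR (spSize n) n 1 1 TS := by
  refine ⟨spSptTree n, rfl, rfl, fun v => ?_, costR_spSptTree n (by omega), spOptTree n, rfl, rfl,
    costR_spOptTree n, ?_⟩
  · rw [relayDist_eq_depth (d := spDepth n) (spSptTree n) rfl (spDepth_sptParent n),
      SimpleGraph.dist_eq_depth (d := spDepth n) rfl (spDepth_sptParent n)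
        (spGraph_adj_sptParent n) (spDepth_le_of_adj n)]
  · rw [costR_spOptTree, costR_spSptTree n (by omega)]
    linarith

end SPTLB
end

section
/- Let (G, w, U, s, r, q) be an instance of the Capacitated Network Design problem, let α' ≥ 1 and β' ≥ 1 be reals, and let R = (P_u)_{u∈U} be a route such that (1) for every source u ∈ U, the length l(P_u) of the path P_u is at most α' times dist_G(u,r), and (2) the total length Σ_{e ∈ E(R)} w(e) of the edges used by R is at most β' times the minimum total edge length of a connected subgraph of G containing U ∪ {r} (a minimum Steiner tree for U ∪ {r}). Then COST_CND(R) ≤ (α'+β')·COST_CND(R') for every route R'. -/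
open Finset

variable {V : Type*} [Fintype V] [DecidableEq V]

/-- A route for the Capacitated Network Design problem: a choice, for each source `u ∈ U`,
of a path `P_u` from `u` to the sink `r` in `G`. -/
def Route (G : SimpleGraph V) (U : Finset V) (r : V) : Type _ :=
  ∀ u : {x // x ∈ U}, G.Path u.1 r

/-- `E(R)`: the set of edges used by at least one path of the route `R`. -/
def routeEdges {G : SimpleGraph V} {U : Finset V} {r : V} (R : Route G U r) :
    Finset (Sym2 V) :=
  U.attach.biUnion fun u => ((R u : G.Walk u.1 r).edges).toFinset

open scoped Classical in
/-- `z(e) = (Σ_{u : e ∈ P_u} s(u))/q`: the total demand routed through `e`, divided by the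
capacity `q`. -/
noncomputable def zval {G : SimpleGraph V} {U : Finset V} {r : V}
    (s : V → ℕ) (q : ℕ) (R : Route G U r) (e : Sym2 V) : ℝ :=
  (∑ u ∈ U.attach, if e ∈ (R u : G.Walk u.1 r).edges then (s u.1 : ℝ) else 0) / (q : ℝ)

/-- `COST_CND(R) = Σ_{e ∈ E(R)} ⌈z(e)⌉·w(e)`: the cost of installing the facilities of the
route `R`, where `w e` is the length of the edge `e`. -/
noncomputable def costCND {G : SimpleGraph V} {U : Finset V} {r : V}
    (s : V → ℕ) (q : ℕ) (w : Sym2 V → ℝ) (R : Route G U r) : ℝ :=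
  ∑ e ∈ routeEdges R, (⌈zval s q R e⌉ : ℝ) * w e

/-- `l(p)`: the total length of a walk `p` with respect to edge lengths `w`. -/
noncomputable def walkLen (w : Sym2 V → ℝ) {G : SimpleGraph V} {a b : V}
    (p : G.Walk a b) : ℝ :=
  (p.edges.map w).sum

/-- `dist_G(a,b)`: the minimum total length of an `a`–`b` path in `G`. -/
noncomputable def wdist (G : SimpleGraph V) (w : Sym2 V → ℝ) (a b : V) : ℝ :=
  sInf {x : ℝ | ∃ p : G.Walk a b, p.IsPath ∧ walkLen w p = x}

/-- The minimum total edge length of a connected subgraph of `G` containing `U ∪ {r}`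
(a minimum Steiner tree for `U ∪ {r}`). -/
noncomputable def steinerWeight (G : SimpleGraph V) (w : Sym2 V → ℝ)
    (U : Finset V) (r : V) : ℝ :=
  sInf {x : ℝ | ∃ H : G.Subgraph, H.Connected ∧ (↑U ∪ {r} : Set V) ⊆ H.verts ∧
    ∑ e ∈ H.edgeSet.toFinite.toFinset, w e = x}

theorem walkLen_nonneg {G : SimpleGraph V} {w : Sym2 V → ℝ} (hw : ∀ e ∈ G.edgeSet, 0 < w e)
    {a b : V} (p : G.Walk a b) : 0 ≤ walkLen w p := by
  refine List.sum_nonneg fun x hx => ?_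
  obtain ⟨e, he, rfl⟩ := List.mem_map.1 hx
  exact (hw e (p.edges_subset_edgeSet he)).le

theorem wdist_le_walkLen {G : SimpleGraph V} {w : Sym2 V → ℝ} (hw : ∀ e ∈ G.edgeSet, 0 < w e)
    {a b : V} (p : G.Path a b) : wdist G w a b ≤ walkLen w (p : G.Walk a b) := by
  refine csInf_le ⟨0, ?_⟩ ⟨p, p.2, rfl⟩
  rintro x ⟨p, -, rfl⟩
  exact walkLen_nonneg hw p

theorem walkLen_path_eq_sum {G : SimpleGraph V} (w : Sym2 V → ℝ) {a b : V} (p : G.Path a b) :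
    walkLen w (p : G.Walk a b) = ∑ e ∈ (p : G.Walk a b).edges.toFinset, w e :=
  (List.sum_toFinset w p.2.isTrail.edges_nodup).symm

theorem mem_routeEdges {G : SimpleGraph V} {U : Finset V} {r : V} {R : Route G U r}
    {e : Sym2 V} : e ∈ routeEdges R ↔ ∃ u, e ∈ (R u : G.Walk u.1 r).edges := by
  simp [routeEdges]

theorem routeEdges_subset_edgeSet {G : SimpleGraph V} {U : Finset V} {r : V} {R : Route G U r}
    {e : Sym2 V} (he : e ∈ routeEdges R) : e ∈ G.edgeSet := by
  obtain ⟨u, hu⟩ := mem_routeEdges.1 he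
  exact (R u : G.Walk u.1 r).edges_subset_edgeSet hu

/-- Exchanging the order of summation: the fractional cost of a route is the demand-weighted total
length of its paths, divided by the capacity. -/
theorem sum_zval_mul {G : SimpleGraph V} {U : Finset V} {r : V} (s : V → ℕ) (q : ℕ)
    (w : Sym2 V → ℝ) (R : Route G U r) :
    ∑ e ∈ routeEdges R, zval s q R e * w e =
      (∑ u ∈ U.attach, (s u.1 : ℝ) * walkLen w (R u : G.Walk u.1 r)) / q := by
  classical
  simp only [zval, div_mul_eq_mul_div, ← Finset.sum_div, Finset.sum_mul]
  rw [Finset.sum_comm]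
  congr 1
  refine Finset.sum_congr rfl fun u _ => ?_
  rw [walkLen_path_eq_sum, Finset.mul_sum]
  simp only [ite_mul, zero_mul]
  rw [← Finset.sum_filter]
  refine Finset.sum_congr ?_ fun _ _ => rfl
  ext e
  simp only [Finset.mem_filter, mem_routeEdges, List.mem_toFinset]
  exact ⟨fun h => h.2, fun h => ⟨⟨u, h⟩, h⟩⟩

theorem zval_pos {G : SimpleGraph V} {U : Finset V} {r : V} {s : V → ℕ}
    (hs : ∀ u ∈ U, 1 ≤ s u) {q : ℕ} (hq : 1 ≤ q) {R : Route G U r} {e : Sym2 V}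
    (he : e ∈ routeEdges R) : 0 < zval s q R e := by
  obtain ⟨u, hu⟩ := mem_routeEdges.1 he
  refine div_pos (Finset.sum_pos' (fun _ _ => by split_ifs <;> positivity)
    ⟨u, Finset.mem_attach _ _, ?_⟩) (by exact_mod_cast hq)
  rw [if_pos hu]
  exact_mod_cast hs u.1 u.2

theorem sum_zval_mul_le_costCND {G : SimpleGraph V} {w : Sym2 V → ℝ}
    (hw : ∀ e ∈ G.edgeSet, 0 < w e) {U : Finset V} {r : V} (s : V → ℕ) (q : ℕ)
    (R : Route G U r) : ∑ e ∈ routeEdges R, zval s q R e * w e ≤ costCND s q w R :=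
  Finset.sum_le_sum fun e he =>
    mul_le_mul_of_nonneg_right (Int.le_ceil _) (hw e (routeEdges_subset_edgeSet he)).le

theorem costCND_le_sum_add_sum {G : SimpleGraph V} {w : Sym2 V → ℝ}
    (hw : ∀ e ∈ G.edgeSet, 0 < w e) {U : Finset V} {r : V} (s : V → ℕ) (q : ℕ)
    (R : Route G U r) :
    costCND s q w R ≤ ∑ e ∈ routeEdges R, zval s q R e * w e + ∑ e ∈ routeEdges R, w e := by
  rw [← Finset.sum_add_distrib]
  refine Finset.sum_le_sum fun e he => ?_
  have h := mul_le_mul_of_nonneg_right (Int.ceil_lt_add_one (zval s q R e)).le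
    (hw e (routeEdges_subset_edgeSet he)).le
  rwa [add_mul, one_mul] at h

theorem sum_routeEdges_le_costCND {G : SimpleGraph V} {w : Sym2 V → ℝ}
    (hw : ∀ e ∈ G.edgeSet, 0 < w e) {U : Finset V} {r : V} {s : V → ℕ}
    (hs : ∀ u ∈ U, 1 ≤ s u) {q : ℕ} (hq : 1 ≤ q) (R : Route G U r) :
    ∑ e ∈ routeEdges R, w e ≤ costCND s q w R := by
  refine Finset.sum_le_sum fun e he => ?_
  have h : (1 : ℝ) ≤ (⌈zval s q R e⌉ : ℝ) := by
    exact_mod_cast Int.one_le_ceil_iff.2 (zval_pos hs hq he)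
  exact le_mul_of_one_le_left (hw e (routeEdges_subset_edgeSet he)).le h

/-- The union of finitely many paths of a route, together with the sink, is connected. -/
theorem exists_connected_subgraph_of_route {G : SimpleGraph V} {U : Finset V} {r : V}
    (R : Route G U r) (T : Finset {x // x ∈ U}) :
    ∃ H : G.Subgraph, H.Connected ∧ r ∈ H.verts ∧ (∀ u ∈ T, u.1 ∈ H.verts) ∧
      ∀ e ∈ H.edgeSet, e ∈ routeEdges R := by
  induction T using Finset.induction_on with
  | empty =>
    exact ⟨G.singletonSubgraph r, SimpleGraph.Subgraph.singletonSubgraph_connected,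
      by simp, by simp, by simp⟩
  | insert u T _ ih =>
    obtain ⟨H, hc, hr, hT, hE⟩ := ih
    refine ⟨H ⊔ (R u : G.Walk u.1 r).toSubgraph,
      SimpleGraph.Subgraph.connected_sup hc.preconnected
        (R u : G.Walk u.1 r).toSubgraph_connected.preconnected
        ⟨r, hr, (R u : G.Walk u.1 r).end_mem_verts_toSubgraph⟩, Or.inl hr, ?_, ?_⟩
    · intro v hv
      rcases Finset.mem_insert.1 hv with rfl | hv
      · exact Or.inr (SimpleGraph.Walk.start_mem_verts_toSubgraph _)
      · exact Or.inl (hT v hv)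
    · intro e he
      rw [SimpleGraph.Subgraph.edgeSet_sup] at he
      rcases he with he | he
      · exact hE e he
      · exact mem_routeEdges.2 ⟨u, (SimpleGraph.Walk.mem_edges_toSubgraph _).1 he⟩

theorem steinerWeight_le_sum_routeEdges {G : SimpleGraph V} {w : Sym2 V → ℝ}
    (hw : ∀ e ∈ G.edgeSet, 0 < w e) {U : Finset V} {r : V} (R : Route G U r) :
    steinerWeight G w U r ≤ ∑ e ∈ routeEdges R, w e := by
  obtain ⟨H, hc, hr, hU, hE⟩ := exists_connected_subgraph_of_route R Finset.univ
  have hbdd : BddBelow {x : ℝ | ∃ H : G.Subgraph, H.Connected ∧ (↑U ∪ {r} : Set V) ⊆ H.verts ∧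
      ∑ e ∈ H.edgeSet.toFinite.toFinset, w e = x} := by
    refine ⟨0, ?_⟩
    rintro x ⟨K, -, -, rfl⟩
    exact Finset.sum_nonneg fun e he =>
      (hw e (K.edgeSet_subset ((Set.Finite.mem_toFinset _).1 he))).le
  refine (csInf_le hbdd ⟨H, hc, ?_, rfl⟩).trans
    (Finset.sum_le_sum_of_subset_of_nonneg ?_ fun e he _ =>
      (hw e (routeEdges_subset_edgeSet he)).le)
  · rintro v (hv | rfl)
    · exact hU ⟨v, hv⟩ (Finset.mem_univ _)
    · exact hr
  · exact fun e he => hE e ((Set.Finite.mem_toFinset _).1 he)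

/-- Salman's lemma: if a route `R` stretches each source's distance by at most `α'` and
uses edges of total length at most `β'` times a minimum Steiner tree, then
`COST_CND(R) ≤ (α'+β')·COST_CND(R')` for every route `R'`. -/
theorem salman_lemma (G : SimpleGraph V) (hG : G.Connected)
    (w : Sym2 V → ℝ) (hw : ∀ e ∈ G.edgeSet, 0 < w e)
    (U : Finset V) (r : V) (hr : r ∉ U)
    (s : V → ℕ) (hs : ∀ u ∈ U, 1 ≤ s u) (q : ℕ) (hq : 1 ≤ q)
    (α' β' : ℝ) (hα : 1 ≤ α') (hβ : 1 ≤ β')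
    (R : Route G U r)
    (h1 : ∀ u : {x // x ∈ U}, walkLen w (R u : G.Walk u.1 r) ≤ α' * wdist G w u.1 r)
    (h2 : ∑ e ∈ routeEdges R, w e ≤ β' * steinerWeight G w U r)
    (R' : Route G U r) :
    costCND s q w R ≤ (α' + β') * costCND s q w R' := by
  have hz : ∑ e ∈ routeEdges R, zval s q R e * w e ≤
      α' * ∑ e ∈ routeEdges R', zval s q R' e * w e := by
    rw [sum_zval_mul, sum_zval_mul, ← mul_div_assoc, Finset.mul_sum]
    refine div_le_div_of_nonneg_right (Finset.sum_le_sum fun u _ => ?_) (Nat.cast_nonneg q)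
    rw [mul_left_comm]
    exact mul_le_mul_of_nonneg_left ((h1 u).trans (mul_le_mul_of_nonneg_left
      (wdist_le_walkLen hw (R' u)) (by linarith))) (Nat.cast_nonneg _)
  calc costCND s q w R
      ≤ ∑ e ∈ routeEdges R, zval s q R e * w e + ∑ e ∈ routeEdges R, w e :=
        costCND_le_sum_add_sum hw s q R
    _ ≤ α' * costCND s q w R' + β' * costCND s q w R' :=
        add_le_add
          (hz.trans (mul_le_mul_of_nonneg_left (sum_zval_mul_le_costCND hw s q R') (by linarith)))
          (h2.trans (mul_le_mul_of_nonneg_left ((steinerWeight_le_sum_routeEdges hw R').trans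
            (sum_routeEdges_le_costCND hw hs hq R')) (by linarith)))
    _ = (α' + β') * costCND s q w R' := (add_mul _ _ _).symm
end

section
/- Let G be a finite connected simple graph with sink r, sources U ⊆ V∖{r}, report sizes s with s(u) ≥ 1 for u ∈ U and s(v) = 0 otherwise, aggregation ratio q ≥ 1, and Tx, Rx > 0. Suppose T is a routing tree with relay nodes such that (1) for every u ∈ U, the hop distance from u to r in T is at most 3 times the hop distance from u to r in G, and (2) the number of edges of T is at most 4 times the minimum number of edges of a connected subgraph of G containing U ∪ {r}. Then COST(T) ≤ 7·COST(T') for every routing tree with relay nodes T'. -/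
open Finset

variable {V : Type*} [Fintype V] [DecidableEq V]

set_option linter.unusedSectionVars false

namespace RelayTree

variable {G : SimpleGraph V} {r : V} {U : Finset V}

lemma iterate_mem (T : RelayTree G r U) {v : V} (hv : v ∈ T.verts) (n : ℕ) :
    T.parent^[n] v ∈ T.verts := by
  induction n with
  | zero => exact hv
  | succ n ih => rw [Function.iterate_succ_apply']; exact T.parent_mem _ ih

lemma iterate_relayDist (T : RelayTree G r U) {v : V} (hv : v ∈ T.verts) :
    T.parent^[relayDist T v] v = r :=
  Nat.sInf_mem (s := {n : ℕ | T.parent^[n] v = r}) (T.reaches v hv)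

lemma iterate_ne_root (T : RelayTree G r U) {v : V} {n : ℕ} (hn : n < relayDist T v) :
    T.parent^[n] v ≠ r :=
  fun h => Nat.notMem_of_lt_sInf hn h

lemma iterate_eq_root_of_le (T : RelayTree G r U) {v : V} (hv : v ∈ T.verts) {n : ℕ}
    (hn : relayDist T v ≤ n) : T.parent^[n] v = r := by
  obtain ⟨k, rfl⟩ := Nat.exists_eq_add_of_le' hn
  rw [Function.iterate_add_apply, T.iterate_relayDist hv]
  exact Function.iterate_fixed T.parent_root k

lemma dist_le_of_iterate_eq_root (T : RelayTree G r U) (hG : G.Connected) (n : ℕ) :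
    ∀ v ∈ T.verts, T.parent^[n] v = r → G.dist v r ≤ n := by
  induction n with
  | zero => intro v _ h; simp_all
  | succ n ih =>
    intro v hv h
    by_cases hvr : v = r
    · simp [hvr]
    · have h₁ := ih _ (T.parent_mem v hv) (by rwa [Function.iterate_succ_apply] at h)
      have h₂ := SimpleGraph.dist_eq_one_iff_adj.2 (T.adj v hv hvr)
      have h₃ := hG.dist_triangle (u := v) (v := T.parent v) (w := r)
      omega

lemma dist_le_relayDist (T : RelayTree G r U) (hG : G.Connected) {v : V} (hv : v ∈ T.verts) :
    G.dist v r ≤ relayDist T v :=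
  T.dist_le_of_iterate_eq_root hG _ v hv (T.iterate_relayDist hv)

lemma injOn_iterate (T : RelayTree G r U) {v : V} (hv : v ∈ T.verts) :
    Set.InjOn (fun n => T.parent^[n] v) (Finset.range (relayDist T v) : Set ℕ) := by
  have key : ∀ i j, i < j → j < relayDist T v → T.parent^[i] v ≠ T.parent^[j] v := by
    intro i j hij hj h
    refine T.iterate_ne_root (v := v) (n := relayDist T v - j + i) (by omega) ?_
    rw [Function.iterate_add_apply, h, ← Function.iterate_add_apply,
      Nat.sub_add_cancel hj.le, T.iterate_relayDist hv]
  intro i hi j hj h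
  simp only [Finset.coe_range, Set.mem_Iio] at hi hj
  rcases lt_trichotomy i j with hij | hij | hij
  · exact (key i j hij hj h).elim
  · exact hij
  · exact (key j i hij hi h.symm).elim

open scoped Classical in
lemma card_ancestors (T : RelayTree G r U) {u : V} (hu : u ∈ T.verts) :
    #{v ∈ T.verts.erase r | ∃ n, T.parent^[n] u = v} = relayDist T u := by
  rw [← Finset.card_range (relayDist T u), ← Finset.card_image_of_injOn (T.injOn_iterate hu)]
  congr 1
  ext v
  simp only [Finset.mem_filter, Finset.mem_erase, Finset.mem_image, Finset.mem_range]
  constructor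
  · rintro ⟨⟨hvr, -⟩, n, rfl⟩
    exact ⟨n, lt_of_not_ge fun h => hvr (T.iterate_eq_root_of_le hu h), rfl⟩
  · rintro ⟨n, hn, rfl⟩
    exact ⟨⟨T.iterate_ne_root hn, T.iterate_mem hu n⟩, n, rfl⟩

open scoped Classical in
lemma desR_add_self (T : RelayTree G r U) (s : V → ℕ) {v : V} (hv : v ∈ T.verts) :
    desR s T v + s v = ∑ u ∈ T.verts, if ∃ n, T.parent^[n] u = v then s u else 0 := by
  have hs : s v = ∑ u ∈ T.verts, if u = v then s u else 0 := by simp [hv]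
  rw [desR, hs, ← Finset.sum_add_distrib]
  refine Finset.sum_congr rfl fun u _ => ?_
  by_cases huv : u = v
  · subst huv
    simp [show ∃ n, T.parent^[n] u = u from ⟨0, rfl⟩]
  · simp [huv]

/-- Double counting: each report is charged once per hop. -/
lemma sum_load (T : RelayTree G r U) (s : V → ℕ) (hs0 : ∀ v, v ∉ U → s v = 0) :
    ∑ v ∈ T.verts.erase r, (desR s T v + s v) = ∑ u ∈ U, s u * relayDist T u := by
  classical
  calc ∑ v ∈ T.verts.erase r, (desR s T v + s v)
      = ∑ v ∈ T.verts.erase r, ∑ u ∈ T.verts, if ∃ n, T.parent^[n] u = v then s u else 0 :=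
        Finset.sum_congr rfl fun v hv => T.desR_add_self s (Finset.mem_of_mem_erase hv)
    _ = ∑ u ∈ T.verts, s u * relayDist T u := by
        rw [Finset.sum_comm]
        refine Finset.sum_congr rfl fun u hu => ?_
        rw [← Finset.sum_filter, Finset.sum_const, T.card_ancestors hu, smul_eq_mul, mul_comm]
    _ = ∑ u ∈ U, s u * relayDist T u :=
        (Finset.sum_subset T.source_subset fun u _ hu => by simp [hs0 u hu]).symm

/-- The vertices of `T` lying on the tree path from some source to the root. -/
def IsUseful (T : RelayTree G r U) (v : V) : Prop :=
  v = r ∨ ∃ u ∈ U, ∃ n, T.parent^[n] u = v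

lemma IsUseful.mem {T : RelayTree G r U} {v : V} (h : T.IsUseful v) : v ∈ T.verts := by
  obtain rfl | ⟨u, hu, n, rfl⟩ := h
  · exact T.root_mem
  · exact T.iterate_mem (T.source_subset hu) n

lemma IsUseful.parent {T : RelayTree G r U} {v : V} (h : T.IsUseful v) :
    T.IsUseful (T.parent v) := by
  obtain rfl | ⟨u, hu, n, rfl⟩ := h
  · exact Or.inl T.parent_root
  · exact Or.inr ⟨u, hu, n + 1, Function.iterate_succ_apply' _ _ _⟩

/-- The subtree of `T` spanned by the sources and the root. -/
def usefulSubgraph (T : RelayTree G r U) : G.Subgraph where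
  verts := {v | T.IsUseful v}
  Adj a b := T.IsUseful a ∧ T.IsUseful b ∧
    ((a ≠ r ∧ T.parent a = b) ∨ (b ≠ r ∧ T.parent b = a))
  adj_sub := by
    rintro a b ⟨ha, hb, ⟨h, rfl⟩ | ⟨h, rfl⟩⟩
    · exact T.adj a ha.mem h
    · exact (T.adj b hb.mem h).symm
  edge_vert := fun h => h.1
  symm := ⟨fun _ _ h => ⟨h.2.1, h.1, h.2.2.symm⟩⟩

lemma usefulSubgraph_reachable (T : RelayTree G r U) (n : ℕ) :
    ∀ v (hv : T.IsUseful v), T.parent^[n] v = r →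
      T.usefulSubgraph.coe.Reachable ⟨v, hv⟩ ⟨r, Or.inl rfl⟩ := by
  induction n with
  | zero =>
    intro v hv h
    obtain rfl : v = r := h
    rfl
  | succ n ih =>
    intro v hv h
    by_cases hvr : v = r
    · subst hvr; rfl
    · refine SimpleGraph.Reachable.trans (SimpleGraph.Adj.reachable ?_) (ih _ hv.parent h)
      exact ⟨hv, hv.parent, Or.inl ⟨hvr, rfl⟩⟩

lemma usefulSubgraph_connected (T : RelayTree G r U) : T.usefulSubgraph.Connected := by
  rw [SimpleGraph.Subgraph.connected_iff', SimpleGraph.connected_iff_exists_forall_reachable]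
  refine ⟨⟨r, Or.inl rfl⟩, ?_⟩
  rintro ⟨v, hv⟩
  obtain ⟨n, hn⟩ := T.reaches v (IsUseful.mem hv)
  exact (T.usefulSubgraph_reachable n v hv hn).symm

open scoped Classical in
lemma steinerEdges_le (T : RelayTree G r U) :
    steinerEdges G U r ≤ #{v ∈ T.verts.erase r | T.IsUseful v} := by
  have hsub : (↑U ∪ {r} : Set V) ⊆ T.usefulSubgraph.verts := by
    rintro v (hv | rfl)
    · exact Or.inr ⟨v, hv, 0, rfl⟩
    · exact Or.inl rfl
  have hle : steinerEdges G U r ≤ T.usefulSubgraph.edgeSet.ncard :=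
    Nat.sInf_le ⟨T.usefulSubgraph, T.usefulSubgraph_connected, hsub, rfl⟩
  refine hle.trans ?_
  refine le_trans ?_ (Finset.card_image_le (f := fun v => s(v, T.parent v)))
  rw [← Set.ncard_coe_finset]
  refine Set.ncard_le_ncard ?_ (Finset.finite_toSet _)
  intro e
  induction e with
  | _ a b =>
    intro (hab : T.usefulSubgraph.Adj a b)
    obtain ⟨ha, hb, ⟨h, rfl⟩ | ⟨h, rfl⟩⟩ := hab <;>
      simp only [Finset.coe_image, Set.mem_image, Finset.mem_coe, Finset.mem_filter,
        Finset.mem_erase]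
    · exact ⟨a, ⟨⟨h, ha.mem⟩, ha⟩, rfl⟩
    · exact ⟨b, ⟨⟨h, hb.mem⟩, hb⟩, Sym2.eq_swap⟩

lemma one_le_load (T : RelayTree G r U) {s : V → ℕ} (hsU : ∀ u ∈ U, 1 ≤ s u) {v : V}
    (hvr : v ≠ r) (hv : T.IsUseful v) : 1 ≤ desR s T v + s v := by
  classical
  rw [T.desR_add_self s hv.mem]
  obtain h | ⟨u, hu, hn⟩ := hv
  · exact absurd h hvr
  · refine (hsU u hu).trans ?_
    have := Finset.single_le_sum
      (f := fun u => if ∃ n, T.parent^[n] u = v then s u else 0)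
      (fun _ _ => Nat.zero_le _) (T.source_subset hu)
    simpa only [if_pos hn] using this

/-- The number of packets sent along `T`, i.e. its cost at unit energy per packet. -/
noncomputable def packets (T : RelayTree G r U) (s : V → ℕ) (q : ℕ) : ℝ :=
  ∑ v ∈ T.verts.erase r, (⌈(((desR s T v + s v : ℕ) : ℝ) / (q : ℝ))⌉ : ℝ)

lemma packets_le (T : RelayTree G r U) (s : V → ℕ) (hs0 : ∀ v, v ∉ U → s v = 0) (q : ℕ) :
    T.packets s q ≤ ((∑ u ∈ U, s u * relayDist T u : ℕ) : ℝ) / q + (#T.verts - 1 : ℕ) := by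
  rw [← T.sum_load s hs0, ← Finset.card_erase_of_mem T.root_mem, packets, Nat.cast_sum,
    Finset.sum_div, Finset.cast_card, ← Finset.sum_add_distrib]
  exact Finset.sum_le_sum fun v _ => (Int.ceil_lt_add_one _).le

lemma le_packets (T : RelayTree G r U) (s : V → ℕ) (hs0 : ∀ v, v ∉ U → s v = 0) (q : ℕ) :
    ((∑ u ∈ U, s u * relayDist T u : ℕ) : ℝ) / q ≤ T.packets s q := by
  rw [← T.sum_load s hs0, packets, Nat.cast_sum, Finset.sum_div]
  exact Finset.sum_le_sum fun v _ => Int.le_ceil _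

lemma steinerEdges_le_packets (T : RelayTree G r U) {s : V → ℕ} (hsU : ∀ u ∈ U, 1 ≤ s u)
    {q : ℕ} (hq : 1 ≤ q) : (steinerEdges G U r : ℝ) ≤ T.packets s q := by
  classical
  refine (Nat.cast_le.2 T.steinerEdges_le).trans ?_
  rw [Finset.cast_card]
  have hnonneg : ∀ v, (0 : ℝ) ≤ ((desR s T v + s v : ℕ) : ℝ) / q := fun v => by positivity
  refine le_trans (Finset.sum_le_sum fun v hv => ?_)
    (Finset.sum_le_sum_of_subset_of_nonneg (Finset.filter_subset _ _)
      fun v _ _ => Int.cast_nonneg (Int.ceil_nonneg (hnonneg v)))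
  simp only [Finset.mem_filter, Finset.mem_erase] at hv
  have hload : 0 < desR s T v + s v := T.one_le_load hsU hv.1.1 hv.2
  have hpos : (0 : ℝ) < ((desR s T v + s v : ℕ) : ℝ) / q :=
    div_pos (Nat.cast_pos.2 hload) (Nat.cast_pos.2 hq)
  exact_mod_cast Int.one_le_ceil_iff.2 hpos

end RelayTree

/-- If a routing tree with relay nodes `T` stretches each source's hop distance by a factor
of at most 3 and uses at most 4 times the minimum Steiner number of edges, then
`COST(T) ≤ 7·COST(T')` for every routing tree with relay nodes `T'`. -/
theorem seven_approximation (G : SimpleGraph V) (hG : G.Connected) (r : V)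
    (U : Finset V) (hU : r ∉ U)
    (s : V → ℕ) (hsU : ∀ u ∈ U, 1 ≤ s u) (hs0 : ∀ v, v ∉ U → s v = 0)
    (q : ℕ) (hq : 1 ≤ q) (Tx Rx : ℝ) (hTx : 0 < Tx) (hRx : 0 < Rx)
    (T : RelayTree G r U)
    (hdist : ∀ u ∈ U, relayDist T u ≤ 3 * G.dist u r)
    (hedges : T.verts.card - 1 ≤ 4 * steinerEdges G U r)
    (T' : RelayTree G r U) :
    costR s q Tx Rx T ≤ 7 * costR s q Tx Rx T' := by
  have hdistT' : ∑ u ∈ U, s u * relayDist T u ≤ 3 * ∑ u ∈ U, s u * relayDist T' u := by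
    rw [Finset.mul_sum]
    refine Finset.sum_le_sum fun u hu => ?_
    have h := T'.dist_le_relayDist hG (T'.source_subset hu)
    calc s u * relayDist T u ≤ s u * (3 * relayDist T' u) :=
          Nat.mul_le_mul_left _ ((hdist u hu).trans (Nat.mul_le_mul_left _ h))
      _ = 3 * (s u * relayDist T' u) := by ring
  have hload : ((∑ u ∈ U, s u * relayDist T u : ℕ) : ℝ) / q ≤ 3 * T'.packets s q :=
    calc ((∑ u ∈ U, s u * relayDist T u : ℕ) : ℝ) / q
        ≤ ((3 * ∑ u ∈ U, s u * relayDist T' u : ℕ) : ℝ) / q := by gcongr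
      _ = 3 * (((∑ u ∈ U, s u * relayDist T' u : ℕ) : ℝ) / q) := by
          rw [Nat.cast_mul, Nat.cast_ofNat, mul_div_assoc]
      _ ≤ 3 * T'.packets s q := by gcongr; exact T'.le_packets s hs0 q
  have hcard : ((#T.verts - 1 : ℕ) : ℝ) ≤ 4 * steinerEdges G U r := by exact_mod_cast hedges
  have hpackets : T.packets s q ≤ 7 * T'.packets s q := by
    linarith [T.packets_le s hs0 q, T'.steinerEdges_le_packets hsU hq]
  calc costR s q Tx Rx T = (Tx + Rx) * T.packets s q := rfl
    _ ≤ (Tx + Rx) * (7 * T'.packets s q) := by gcongr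
    _ = 7 * costR s q Tx Rx T' := mul_left_comm _ _ _
end

section
/- In a finite connected simple graph G with sink r and report sizes s : V → ℕ with s(r) = 0, every shortest path tree is a minimum descendant tree; that is, if T is a routing tree in which every vertex's hop distance to r in T equals its hop distance to r in G, then Σ_{v ≠ r} des_T(v) ≤ Σ_{v ≠ r} des_{T'}(v) for every routing tree T'. -/
open Finset

variable {V : Type*} [Fintype V] [DecidableEq V]

namespace RoutingTree

variable {G : SimpleGraph V} {r : V}

omit [Fintype V] [DecidableEq V] in
theorem iterate_treeDist (T : RoutingTree G r) (v : V) : T.parent^[treeDist r T v] v = r :=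
  Nat.sInf_mem (T.reaches v)

omit [Fintype V] [DecidableEq V] in
theorem treeDist_le (T : RoutingTree G r) {v : V} {n : ℕ} (h : T.parent^[n] v = r) :
    treeDist r T v ≤ n :=
  Nat.sInf_le h

omit [Fintype V] [DecidableEq V] in
theorem iterate_eq_root_iff (T : RoutingTree G r) {v : V} {n : ℕ} :
    T.parent^[n] v = r ↔ treeDist r T v ≤ n := by
  refine ⟨T.treeDist_le, fun h => ?_⟩
  obtain ⟨k, rfl⟩ := Nat.exists_eq_add_of_le' h
  rw [Function.iterate_add_apply, T.iterate_treeDist]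
  exact Function.iterate_fixed T.parent_root k

omit [Fintype V] [DecidableEq V] in
theorem iterate_ne_iterate (T : RoutingTree G r) {v : V} {i j : ℕ} (hij : i < j)
    (hj : j < treeDist r T v) : T.parent^[i] v ≠ T.parent^[j] v := by
  intro h
  have hroot : T.parent^[treeDist r T v - j + i] v = r := by
    rw [Function.iterate_add_apply, h, ← Function.iterate_add_apply, Nat.sub_add_cancel hj.le,
      T.iterate_treeDist]
  have := T.treeDist_le hroot
  omega

omit [Fintype V] [DecidableEq V] in
theorem dist_le_of_iterate_eq_root (T : RoutingTree G r) (hG : G.Connected) {n : ℕ} {v : V}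
    (h : T.parent^[n] v = r) : G.dist v r ≤ n := by
  induction n generalizing v with
  | zero => simp_all
  | succ n ih =>
    by_cases hv : v = r
    · simp [hv]
    · have hadj : G.dist v (T.parent v) = 1 := SimpleGraph.dist_eq_one_iff_adj.2 (T.adj v hv)
      have htri := hG.dist_triangle (u := v) (v := T.parent v) (w := r)
      have := ih (v := T.parent v) h
      omega

open scoped Classical in
theorem card_proper_ancestors (T : RoutingTree G r) (u : V) :
    #{v ∈ univ.erase r | u ≠ v ∧ ∃ n, T.parent^[n] u = v} = treeDist r T u - 1 := by
  have himage : {v ∈ univ.erase r | u ≠ v ∧ ∃ n, T.parent^[n] u = v} =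
      (Ico 1 (treeDist r T u)).image fun n => T.parent^[n] u := by
    ext v
    simp only [mem_filter, mem_erase, mem_univ, and_true, mem_image, mem_Ico]
    constructor
    · rintro ⟨hvr, huv, n, rfl⟩
      refine ⟨n, ⟨Nat.one_le_iff_ne_zero.2 ?_, ?_⟩, rfl⟩
      · rintro rfl
        exact huv rfl
      · exact not_le.1 fun h => hvr (T.iterate_eq_root_iff.2 h)
    · rintro ⟨n, ⟨hn, hlt⟩, rfl⟩
      exact ⟨fun h => (T.treeDist_le h).not_gt hlt, T.iterate_ne_iterate hn hlt, n, rfl⟩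
  rw [himage, card_image_of_injOn, Nat.card_Ico]
  intro i hi j hj hij
  simp only [coe_Ico, Set.mem_Ico] at hi hj
  rcases lt_trichotomy i j with h | h | h
  · exact absurd hij (T.iterate_ne_iterate h hj.2)
  · exact h
  · exact absurd hij.symm (T.iterate_ne_iterate h hi.2)

theorem sum_des (s : V → ℕ) (T : RoutingTree G r) :
    ∑ v ∈ univ.erase r, des s T v = ∑ u, (treeDist r T u - 1) * s u := by
  classical
  unfold des
  rw [sum_comm]
  refine sum_congr rfl fun u _ => ?_
  rw [← sum_filter, sum_const, smul_eq_mul, ← T.card_proper_ancestors u]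

end RoutingTree

/-- Every shortest path tree is a minimum descendant tree: if every vertex's hop distance
to `r` in `T` equals its hop distance in `G`, then `Σ_{v ≠ r} des_T(v)` is minimal among
all routing trees. -/
theorem spt_is_minimum_descendant_tree (G : SimpleGraph V) (hG : G.Connected) (r : V)
    (s : V → ℕ) (hs0 : s r = 0)
    (T : RoutingTree G r) (hT : IsSPT r T) (T' : RoutingTree G r) :
    ∑ v ∈ Finset.univ.erase r, des s T v ≤ ∑ v ∈ Finset.univ.erase r, des s T' v := by
  rw [RoutingTree.sum_des, RoutingTree.sum_des]
  gcongr with u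
  rw [hT u]
  exact T'.dist_le_of_iterate_eq_root hG (T'.iterate_treeDist u)
end

section
/- In a finite connected simple graph G with sink r and report sizes s : V → ℕ with s(r) = 0 and s(v) ≥ 1 for every v ≠ r, every minimum descendant tree is a shortest path tree; that is, if T is a routing tree with Σ_{v ≠ r} des_T(v) ≤ Σ_{v ≠ r} des_{T'}(v) for every routing tree T', then for every vertex v the hop distance from v to r in T equals the hop distance from v to r in G. -/
open Finset

variable {V : Type*} [Fintype V] [DecidableEq V]

section Helpers

variable {G : SimpleGraph V} {r : V}

omit [Fintype V] [DecidableEq V] in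
theorem parent_iterate_treeDist (T : RoutingTree G r) (v : V) :
    T.parent^[treeDist r T v] v = r :=
  Nat.sInf_mem (s := {n : ℕ | T.parent^[n] v = r}) (T.reaches v)

omit [Fintype V] [DecidableEq V] in
theorem treeDist_le (T : RoutingTree G r) {v : V} {n : ℕ} (h : T.parent^[n] v = r) :
    treeDist r T v ≤ n :=
  Nat.sInf_le h

omit [Fintype V] [DecidableEq V] in
theorem parent_iterate_eq_root_iff (T : RoutingTree G r) (v : V) (n : ℕ) :
    T.parent^[n] v = r ↔ treeDist r T v ≤ n := by
  refine ⟨treeDist_le T, fun h => ?_⟩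
  obtain ⟨k, rfl⟩ := Nat.exists_eq_add_of_le' h
  rw [Function.iterate_add_apply, parent_iterate_treeDist,
    Function.iterate_fixed T.parent_root]

omit [Fintype V] [DecidableEq V] in
/-- The vertices on the tree path from `v`, before it reaches the root, are distinct. -/
theorem parent_iterate_injOn (T : RoutingTree G r) (v : V) :
    Set.InjOn (fun n => T.parent^[n] v) (Set.Iio (treeDist r T v)) := by
  have key : ∀ i j, i < j → j < treeDist r T v → T.parent^[i] v ≠ T.parent^[j] v := by
    intro i j hij hj h
    have h' : T.parent^[treeDist r T v - j + i] v = r := by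
      rw [Function.iterate_add_apply, h, ← Function.iterate_add_apply,
        Nat.sub_add_cancel hj.le, parent_iterate_treeDist]
    have := treeDist_le T h'
    omega
  intro i hi j hj h
  rcases lt_trichotomy i j with hij | hij | hij
  · exact absurd h (key i j hij hj)
  · exact hij
  · exact absurd h.symm (key j i hij hi)

open scoped Classical in
theorem card_proper_ancestors (T : RoutingTree G r) (u : V) :
    #{v ∈ Finset.univ.erase r | u ≠ v ∧ ∃ n, T.parent^[n] u = v} = treeDist r T u - 1 := by
  have himage : ({v ∈ Finset.univ.erase r | u ≠ v ∧ ∃ n, T.parent^[n] u = v} : Finset V) =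
      (Finset.Ico 1 (treeDist r T u)).image (fun n => T.parent^[n] u) := by
    ext v
    simp only [Finset.mem_filter, Finset.mem_erase, Finset.mem_univ, and_true,
      Finset.mem_image, Finset.mem_Ico]
    constructor
    · rintro ⟨hv, huv, n, rfl⟩
      refine ⟨n, ⟨?_, ?_⟩, rfl⟩
      · rcases n with _ | n
        · exact absurd rfl huv
        · omega
      · rwa [Ne, parent_iterate_eq_root_iff, not_le] at hv
    · rintro ⟨n, ⟨hn, hlt⟩, rfl⟩
      refine ⟨?_, fun h => ?_, n, rfl⟩
      · rwa [Ne, parent_iterate_eq_root_iff, not_le]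
      · have : 0 = n := parent_iterate_injOn T u (Set.mem_Iio.2 (by omega)) hlt h
        omega
  rw [himage, Finset.card_image_of_injOn, Nat.card_Ico]
  exact (parent_iterate_injOn T u).mono fun n hn => (Finset.mem_Ico.1 hn).2

theorem sum_des_eq (s : V → ℕ) (T : RoutingTree G r) :
    ∑ v ∈ Finset.univ.erase r, des s T v = ∑ u, (treeDist r T u - 1) * s u := by
  classical
  simp only [des]
  rw [Finset.sum_comm]
  refine Finset.sum_congr rfl fun u _ => ?_
  rw [← Finset.sum_filter, Finset.sum_const, smul_eq_mul, ← card_proper_ancestors T u]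

omit [Fintype V] in
theorem dist_le_of_parent_iterate (hG : G.Connected) (T : RoutingTree G r) (n : ℕ) (v : V)
    (h : T.parent^[n] v = r) : G.dist v r ≤ n := by
  induction n generalizing v with
  | zero => simp_all
  | succ n ih =>
    by_cases hv : v = r
    · simp [hv]
    · have h1 := SimpleGraph.dist_eq_one_iff_adj.2 (T.adj v hv)
      have h2 := hG.dist_triangle (u := v) (v := T.parent v) (w := r)
      have h3 := ih (T.parent v) h
      omega

omit [Fintype V] [DecidableEq V] in
theorem exists_adj_dist_succ (hG : G.Connected) {v : V} (hv : v ≠ r) :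
    ∃ w, G.Adj v w ∧ G.dist v r = G.dist w r + 1 := by
  obtain ⟨p, hp⟩ := hG.exists_walk_length_eq_dist v r
  cases p with
  | nil => exact absurd rfl hv
  | @cons _ w _ h q =>
    refine ⟨w, h, ?_⟩
    have h1 := SimpleGraph.dist_eq_one_iff_adj.2 h
    have h2 := hG.dist_triangle (u := v) (v := w) (w := r)
    have h3 := SimpleGraph.dist_le q
    rw [SimpleGraph.Walk.length_cons] at hp
    omega

omit [Fintype V] in
theorem exists_isSPT (hG : G.Connected) (r : V) : ∃ T : RoutingTree G r, IsSPT r T := by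
  have hex : ∀ v, ∃ w, (v = r → w = r) ∧
      (v ≠ r → G.Adj v w ∧ G.dist v r = G.dist w r + 1) := by
    intro v
    by_cases hv : v = r
    · exact ⟨r, fun _ => rfl, fun h => absurd hv h⟩
    · obtain ⟨w, hw⟩ := exists_adj_dist_succ hG hv
      exact ⟨w, fun h => absurd h hv, fun _ => hw⟩
  choose f hroot hf using hex
  have hiter : ∀ n v, G.dist v r = n → f^[n] v = r := by
    intro n
    induction n with
    | zero => exact fun v hv => hG.dist_eq_zero_iff.1 hv
    | succ n ih =>
      intro v hv
      have hne : v ≠ r := by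
        rintro rfl
        simp at hv
      have := (hf v hne).2
      exact ih (f v) (by omega)
  let T : RoutingTree G r :=
    { parent := f
      parent_root := hroot r rfl
      adj := fun v hv => (hf v hv).1
      reaches := fun v => ⟨_, hiter _ v rfl⟩ }
  exact ⟨T, fun v => le_antisymm (treeDist_le T (hiter _ v rfl))
    (dist_le_of_parent_iterate hG T _ v (parent_iterate_treeDist T v))⟩

end Helpers

/-- Every minimum descendant tree is a shortest path tree: if `T` minimizes
`Σ_{v ≠ r} des_T(v)` over all routing trees, then every vertex's hop distance to `r` in `T`
equals its hop distance to `r` in `G`. -/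
theorem minimum_descendant_tree_is_spt (G : SimpleGraph V) (hG : G.Connected) (r : V)
    (s : V → ℕ) (hs0 : s r = 0) (hs1 : ∀ v, v ≠ r → 1 ≤ s v)
    (T : RoutingTree G r)
    (hmin : ∀ T' : RoutingTree G r,
      ∑ v ∈ Finset.univ.erase r, des s T v ≤ ∑ v ∈ Finset.univ.erase r, des s T' v) :
    IsSPT r T := by
  obtain ⟨T', hT'⟩ := exists_isSPT hG r
  have hle : ∀ v, G.dist v r ≤ treeDist r T v := fun v =>
    dist_le_of_parent_iterate hG T _ v (parent_iterate_treeDist T v)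
  by_contra hT
  simp only [IsSPT, not_forall] at hT
  obtain ⟨u, hu⟩ := hT
  have hlt : G.dist u r < treeDist r T u := lt_of_le_of_ne (hle u) (Ne.symm hu)
  have hur : u ≠ r := by
    rintro rfl
    have := treeDist_le T (v := u) (n := 0) rfl
    omega
  have hpos : 0 < G.dist u r := hG.pos_dist_of_ne hur
  refine (hmin T').not_gt ?_
  rw [sum_des_eq, sum_des_eq]
  refine Finset.sum_lt_sum (fun v _ => ?_) ⟨u, Finset.mem_univ u, ?_⟩
  · rw [hT' v]
    exact Nat.mul_le_mul_right _ (Nat.sub_le_sub_right (hle v) 1)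
  · rw [hT' u]
    exact Nat.mul_lt_mul_of_pos_right (by omega) (hs1 u hur)
end
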